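/- There is a universal constant c > 0 with the following property. Let n ≥ 3, let K ⊆ ℝⁿ be a centrally-symmetric convex body (K = −K), and let δ > 0. If for every pair of 2-dimensional linear subspaces E, F ⊆ ℝⁿ one has d_BM(K ∩ E, K ∩ F) < 1 + δ, then d_BM(K, Bⁿ) < 1 + c·n²·δ^{1/3}, where Bⁿ is the closed Euclidean unit ball of ℝⁿ. -/

import Mathlib

open Set Metric Pointwise

/-- `dBMlt K L lam` expresses that the (affine) Banach–Mazur distance between the
convex bodies `K ⊆ V` and `L ⊆ W` is `< lam`: there exist an invertible affine map
`T : W → V` and a vector `z ∈ V` with `K ⊆ T(L) ⊆ lam • K + z`. -/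
def dBMlt {V W : Type*} [AddCommGroup V] [Module ℝ V] [AddCommGroup W] [Module ℝ W]
    (K : Set V) (L : Set W) (lam : ℝ) : Prop :=
  ∃ (T : W ≃ᵃ[ℝ] V) (z : V), K ⊆ T '' L ∧ T '' L ⊆ lam • K + {z}

/-- A continuous logarithm of the constant function `1` on the real line is constant. -/
lemma eq_of_exp_eq_one {g : ℝ → ℂ} (hg : Continuous g) (h : ∀ t, Complex.exp (g t) = 1)
    (a b : ℝ) : g a = g b := by
  choose n hn using fun t => Complex.exp_eq_one_iff.1 (h t)
  have hn' : ∀ t, ((n t : ℤ) : ℝ) = (g t).im / (2 * Real.pi) := by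
    intro t
    have hpi := Real.pi_pos
    rw [hn t]
    simp
  have hcont : Continuous n := by
    rw [Int.isClosedEmbedding_coe_real.isInducing.continuous_iff]
    have : ((↑) ∘ n : ℝ → ℝ) = fun t => (g t).im / (2 * Real.pi) := funext hn'
    rw [this]
    fun_prop
  rw [hn a, hn b, PreconnectedSpace.constant inferInstance hcont (x := a) (y := b)]

/-- A homotopy of loops in the plane from winding number `k` to winding number `-k`
passes through the origin when `k ≠ 0`. -/
lemma exists_zero_of_winding {Φ : ℝ × ℝ → ℂ} (hΦ : Continuous Φ) {k : ℤ} (hk : k ≠ 0)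
    (hper : ∀ s, Φ (s, 2 * Real.pi) = Φ (s, 0))
    (h0 : ∀ t : ℝ, Φ (0, t) = Complex.exp (k * t * Complex.I) * Φ (0, 0))
    (h1 : ∀ t : ℝ, Φ (Real.pi, t) = Complex.exp (-(k * t * Complex.I)) * Φ (Real.pi, 0)) :
    ∃ x, Φ x = 0 := by
  by_contra! hne
  have hsc : IsSimplyConnected (univ : Set (ℝ × ℝ)) := by
    rw [IsSimplyConnected]
    exact (Homeomorph.Set.univ (ℝ × ℝ)).toHomotopyEquiv.simplyConnectedSpace
  obtain ⟨f, hfc, hf⟩ := Complex.exists_continuousOn_eqOn_exp_comp hsc isOpen_univ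
    hΦ.continuousOn (by rintro ⟨x, -, hx⟩; exact hne x hx)
  rw [continuousOn_univ] at hfc
  have hf' : ∀ x, Complex.exp (f x) = Φ x := fun x => hf (mem_univ x)
  have hW := eq_of_exp_eq_one (g := fun s => f (s, 2 * Real.pi) - f (s, 0)) (by fun_prop)
    (fun s => by rw [Complex.exp_sub, hf', hf', hper, div_self (hne _)]) 0 Real.pi
  have hA := eq_of_exp_eq_one (g := fun t => f (0, t) - f (0, 0) - k * t * Complex.I)
    (by fun_prop) (fun t => by
      rw [Complex.exp_sub, Complex.exp_sub, hf', hf', h0 t, mul_div_assoc, div_self (hne _),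
        mul_one, div_self (Complex.exp_ne_zero _)]) 0 (2 * Real.pi)
  have hB := eq_of_exp_eq_one
    (g := fun t => f (Real.pi, t) - f (Real.pi, 0) - (-(k * t * Complex.I)))
    (by fun_prop) (fun t => by
      rw [Complex.exp_sub, Complex.exp_sub, hf', hf', h1 t, mul_div_assoc, div_self (hne _),
        mul_one, div_self (Complex.exp_ne_zero _)]) 0 (2 * Real.pi)
  simp only [sub_self, Complex.ofReal_zero, mul_zero, zero_mul, neg_zero] at hA hB hW
  have key : (k : ℂ) * (2 * Real.pi) * Complex.I * 2 = 0 := by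
    push_cast at hA hB
    linear_combination hW + hA - hB
  have hpi : (Real.pi : ℂ) ≠ 0 := by exact_mod_cast Real.pi_ne_zero
  have hk' : (k : ℂ) ≠ 0 := by exact_mod_cast hk
  have : (k : ℂ) * (2 * Real.pi) * Complex.I * 2 ≠ 0 := by
    simp [hk', hpi]
  exact this key

/-- A continuous seminorm is a norm if it only vanishes at the origin; on a finite-dimensional
space such a seminorm dominates a positive multiple of the ambient norm. -/
lemma exists_pos_mul_norm_le {E : Type*} [NormedAddCommGroup E] [NormedSpace ℝ E]
    [FiniteDimensional ℝ E] {p : Seminorm ℝ E} (hp : Continuous p)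
    (hp0 : ∀ x, p x = 0 → x = 0) : ∃ m : ℝ, 0 < m ∧ ∀ x, m * ‖x‖ ≤ p x := by
  have hprop : ProperSpace E := FiniteDimensional.proper_real E
  rcases subsingleton_or_nontrivial E with hE | hE
  · exact ⟨1, one_pos, fun x => by simp [Subsingleton.elim x 0]⟩
  obtain ⟨x₀, hx₀, hmin⟩ := (isCompact_sphere (0 : E) 1).exists_isMinOn
    (NormedSpace.sphere_nonempty.2 zero_le_one) hp.continuousOn
  have hx₀' : ‖x₀‖ = 1 := by simpa using hx₀
  refine ⟨p x₀, lt_of_le_of_ne (apply_nonneg p x₀) fun h => ?_, fun x => ?_⟩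
  · simp [hp0 x₀ h.symm] at hx₀'
  · rcases eq_or_ne x 0 with rfl | hx
    · simp
    have hn : 0 < ‖x‖ := norm_pos_iff.2 hx
    have h := isMinOn_iff.1 hmin (‖x‖⁻¹ • x) (by simp [norm_smul, hn.ne'])
    rw [map_smul_eq_mul, norm_inv, norm_norm] at h
    calc p x₀ * ‖x‖ ≤ ‖x‖⁻¹ * p x * ‖x‖ := by gcongr
      _ = p x := by field_simp

/-- A continuous seminorm on a nontrivial finite-dimensional space attains its maximum and its
minimum on the unit sphere. -/
lemma exists_sphere_max {E : Type*} [NormedAddCommGroup E] [NormedSpace ℝ E]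
    [FiniteDimensional ℝ E] [Nontrivial E] {p : Seminorm ℝ E} (hp : Continuous p) :
    ∃ y, ‖y‖ = 1 ∧ ∀ x, p x ≤ p y * ‖x‖ := by
  have hprop : ProperSpace E := FiniteDimensional.proper_real E
  obtain ⟨x₀, hx₀, hmax⟩ := (isCompact_sphere (0 : E) 1).exists_isMaxOn
    (NormedSpace.sphere_nonempty.2 zero_le_one) hp.continuousOn
  refine ⟨x₀, by simpa using hx₀, fun x => ?_⟩
  rcases eq_or_ne x 0 with rfl | hx
  · simp
  have hn : 0 < ‖x‖ := norm_pos_iff.2 hx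
  have h := isMaxOn_iff.1 hmax (‖x‖⁻¹ • x) (by simp [norm_smul, hn.ne'])
  rw [map_smul_eq_mul, norm_inv, norm_norm] at h
  calc p x = ‖x‖⁻¹ * p x * ‖x‖ := by field_simp
    _ ≤ p x₀ * ‖x‖ := by gcongr

lemma exists_sphere_min {E : Type*} [NormedAddCommGroup E] [NormedSpace ℝ E]
    [FiniteDimensional ℝ E] [Nontrivial E] {p : Seminorm ℝ E} (hp : Continuous p) :
    ∃ y, ‖y‖ = 1 ∧ ∀ x, p y * ‖x‖ ≤ p x := by
  have hprop : ProperSpace E := FiniteDimensional.proper_real E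
  obtain ⟨x₀, hx₀, hmin⟩ := (isCompact_sphere (0 : E) 1).exists_isMinOn
    (NormedSpace.sphere_nonempty.2 zero_le_one) hp.continuousOn
  refine ⟨x₀, by simpa using hx₀, fun x => ?_⟩
  rcases eq_or_ne x 0 with rfl | hx
  · simp
  have hn : 0 < ‖x‖ := norm_pos_iff.2 hx
  have h := isMinOn_iff.1 hmin (‖x‖⁻¹ • x) (by simp [norm_smul, hn.ne'])
  rw [map_smul_eq_mul, norm_inv, norm_norm] at h
  calc p x₀ * ‖x‖ ≤ ‖x‖⁻¹ * p x * ‖x‖ := by gcongr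
    _ = p x := by field_simp

/-- The John position of a norm: the Euclidean unit ball is an ellipsoid of maximal volume in the
unit ball of `p ∘ T`, which is tested against the rank-one stretchings `y ↦ y + s ⟪x, y⟫ x`. -/
lemma exists_john_position {E : Type*} [NormedAddCommGroup E] [InnerProductSpace ℝ E]
    [FiniteDimensional ℝ E] [Nontrivial E] {p : Seminorm ℝ E} (hp : Continuous p)
    (hp0 : ∀ x, p x = 0 → x = 0) :
    ∃ T : E ≃L[ℝ] E, (∀ x, p (T x) ≤ ‖x‖) ∧ ∀ x, ‖x‖ = 1 → ∀ s : ℝ, 0 ≤ s →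
      ∃ y, ‖y‖ = 1 ∧ 1 + s ≤ p (T (y + (s * inner ℝ x y) • x)) ^ Module.finrank ℝ E := by
  obtain ⟨m, hm, hmp⟩ := exists_pos_mul_norm_le hp hp0
  obtain ⟨yM, hyM, hM⟩ := exists_sphere_max hp
  have hMpos : 0 < p yM := by
    have := hmp yM
    rw [hyM] at this
    linarith
  have hprop : ProperSpace (E →L[ℝ] E) := FiniteDimensional.proper_real _
  set S : Set (E →L[ℝ] E) := {T | ∀ x, p (T x) ≤ ‖x‖} with hS
  have hSclosed : IsClosed S := by
    have : S = ⋂ x, {T : E →L[ℝ] E | p (T x) ≤ ‖x‖} := by ext; simp [hS]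
    rw [this]
    exact isClosed_iInter fun x => isClosed_le
      (hp.comp (ContinuousLinearMap.apply ℝ E x).continuous) continuous_const
  have hSbdd : S ⊆ closedBall 0 (m⁻¹) := by
    intro T hT
    rw [mem_closedBall_zero_iff]
    refine ContinuousLinearMap.opNorm_le_bound _ (by positivity) fun x => ?_
    have h1 := (hmp (T x)).trans (hT x)
    rw [inv_mul_eq_div, le_div_iff₀ hm]
    linarith
  have hScpt : IsCompact S := (isCompact_closedBall _ _).of_isClosed_subset hSclosed hSbdd
  have hT₁ : ((p yM)⁻¹ • ContinuousLinearMap.id ℝ E) ∈ S := fun x => by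
    have := hM x
    simp only [smul_apply, ContinuousLinearMap.id_apply, map_smul_eq_mul,
      norm_inv, Real.norm_of_nonneg hMpos.le]
    rw [inv_mul_eq_div, div_le_iff₀ hMpos]
    linarith
  obtain ⟨T, hTS, hTmax⟩ := hScpt.exists_isMaxOn (f := fun T : E →L[ℝ] E => |T.det|) ⟨_, hT₁⟩
    (ContinuousLinearMap.continuous_det.abs).continuousOn
  have hTmax' : ∀ T' ∈ S, |T'.det| ≤ |T.det| := isMaxOn_iff.1 hTmax
  have hdet : 0 < |T.det| := by
    refine lt_of_lt_of_le ?_ (hTmax' _ hT₁)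
    rw [abs_pos, ContinuousLinearMap.det, ContinuousLinearMap.toLinearMap_smul, LinearMap.det_smul]
    simp [hMpos.ne']
  set Te : E ≃L[ℝ] E := T.toContinuousLinearEquivOfDetNeZero (abs_pos.1 hdet) with hTe
  have hTeT : ∀ x, Te x = T x := fun x => rfl
  refine ⟨Te, fun x => hTS x, fun x hx s hs => ?_⟩
  set D : E →L[ℝ] E := ContinuousLinearMap.id ℝ E + s • (innerSL ℝ x).smulRight x with hD
  have hDapp : ∀ y, D y = y + (s * inner ℝ x y) • x := fun y => by
    simp [hD, smul_smul]
  have hDdet : D.det = 1 + s := by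
    have : (D : E →ₗ[ℝ] E) = LinearMap.transvection (innerSL ℝ x : E →ₗ[ℝ] ℝ) (s • x) := by
      ext y
      simp [hD, LinearMap.transvection.apply, smul_smul, mul_comm]
    rw [ContinuousLinearMap.det, this, LinearMap.transvection.det]
    simp [hx]
  have hinj : ∀ y, T (D y) = 0 → y = 0 := by
    intro y hy
    have h1 : D y = 0 := Te.injective (by rw [hTeT, hy, map_zero])
    have h2 : (D : E →ₗ[ℝ] E) y = 0 := h1
    have h3 : LinearMap.ker (D : E →ₗ[ℝ] E) = ⊥ :=
      ((D : E →ₗ[ℝ] E).equivOfDetNeZero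
        (by rw [show LinearMap.det (D : E →ₗ[ℝ] E) = 1 + s from hDdet]; positivity)).ker
    simpa [h3] using LinearMap.mem_ker.2 h2
  obtain ⟨y, hy, hymax⟩ := exists_sphere_max (p := p.comp ((T.comp D : E →L[ℝ] E) : E →ₗ[ℝ] E))
    (hp.comp (T.comp D).continuous)
  have hymax' : ∀ z, p (T (D z)) ≤ p (T (D y)) * ‖z‖ := hymax
  refine ⟨y, hy, ?_⟩
  rw [← hDapp, hTeT]
  set r := p (T (D y)) with hr
  have hrpos : 0 < r := by
    refine lt_of_le_of_ne (apply_nonneg p _) fun h => ?_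
    have := hinj y (hp0 _ h.symm)
    simp [this] at hy
  have hmem : r⁻¹ • T.comp D ∈ S := fun z => by
    have := hymax' z
    simp only [smul_apply, ContinuousLinearMap.comp_apply, map_smul_eq_mul,
      norm_inv, Real.norm_of_nonneg hrpos.le]
    rw [inv_mul_eq_div, div_le_iff₀ hrpos]
    linarith
  have hfin := hTmax' _ hmem
  rw [ContinuousLinearMap.det, ContinuousLinearMap.toLinearMap_smul, LinearMap.det_smul,
    ContinuousLinearMap.toLinearMap_comp, LinearMap.det_comp,
    show LinearMap.det (D : E →ₗ[ℝ] E) = 1 + s from hDdet, abs_mul, abs_mul,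
    abs_of_pos (show 0 < 1 + s by positivity), abs_pow, abs_inv, abs_of_pos hrpos] at hfin
  have hfin' : (r⁻¹) ^ Module.finrank ℝ E * (1 + s) ≤ 1 := by
    have : (r⁻¹) ^ Module.finrank ℝ E * (1 + s) * |T.det| ≤ 1 * |T.det| := by
      rw [one_mul]
      calc _ = _ := by ring
        _ ≤ _ := hfin
    exact le_of_mul_le_mul_right this hdet
  rwa [inv_pow, inv_mul_eq_div, div_le_one (by positivity)] at hfin'

lemma john_position_lower_bound {E : Type*} [NormedAddCommGroup E] [InnerProductSpace ℝ E]
    [FiniteDimensional ℝ E] [Nontrivial E] {p : Seminorm ℝ E} (hple : ∀ x, p x ≤ ‖x‖)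
    {x : E} (hx : ‖x‖ = 1)
    (hJ : ∀ s : ℝ, 0 ≤ s → ∃ y, ‖y‖ = 1 ∧
      1 + s ≤ p (y + (s * inner ℝ x y) • x) ^ Module.finrank ℝ E) :
    1 ≤ 2 * Module.finrank ℝ E * p x := by
  have hdpos : 0 < Module.finrank ℝ E := Module.finrank_pos
  set d := Module.finrank ℝ E with hd
  have hd' : (0 : ℝ) < d := by exact_mod_cast hdpos
  set s : ℝ := (1 + 1 / d) ^ d - 1 with hs
  have hs0 : 0 ≤ s := by
    have : (1 : ℝ) ≤ (1 + 1 / d) ^ d := one_le_pow₀ (by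
      have : (0 : ℝ) < 1 / d := by positivity
      linarith)
    linarith
  have hs2 : s ≤ 2 := by
    have h1 : (1 + 1 / d : ℝ) ^ d ≤ Real.exp (1 / d) ^ d := by
      gcongr
      rw [add_comm]
      exact Real.add_one_le_exp _
    rw [← Real.exp_nat_mul, mul_one_div_cancel hd'.ne'] at h1
    have := Real.exp_one_lt_d9
    linarith
  obtain ⟨y, hy, h⟩ := hJ s hs0
  have hin : |inner ℝ x y| ≤ 1 := by
    have := abs_real_inner_le_norm x y
    rwa [hx, hy, one_mul] at this
  have hp : p (y + (s * inner ℝ x y) • x) ≤ 1 + s * p x := by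
    refine (map_add_le_add p _ _).trans ?_
    rw [map_smul_eq_mul, Real.norm_eq_abs, abs_mul, abs_of_nonneg hs0]
    have h1 := hple y
    rw [hy] at h1
    have h2 : s * |inner ℝ x y| * p x ≤ s * 1 * p x := by gcongr
    linarith
  have h3 : (1 + 1 / d : ℝ) ^ d ≤ (1 + s * p x) ^ d := by
    calc (1 + 1 / d : ℝ) ^ d = 1 + s := by rw [hs]; ring
      _ ≤ _ := h
      _ ≤ _ := by gcongr
  have h4 : (1 + 1 / d : ℝ) ≤ 1 + s * p x :=
    le_of_pow_le_pow_left₀ hdpos.ne' (by positivity) h3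
  have h5 : s * p x ≤ 2 * p x := by gcongr
  have h6 : (1 : ℝ) / d ≤ 2 * p x := by linarith
  rw [div_le_iff₀ hd'] at h6
  linarith

lemma sq_le_mul_of_forall_nonneg {a b c : ℝ}
    (h : ∀ X Y : ℝ, 0 ≤ a * X ^ 2 + 2 * b * X * Y + c * Y ^ 2) :
    b ^ 2 ≤ a * c := by
  have := discrim_le_zero (a := a) (b := 2 * b) (c := c) (fun x => by
    have := h x 1
    nlinarith)
  rw [discrim] at this
  nlinarith

/-- If a quadratic form on the plane lies below the Euclidean one, is almost minimal at `(1, 0)`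
and almost touches it at a point `(α, β)` far from the second axis, then it is almost
Euclidean. -/
lemma planar_form_estimate {a b c m ε σ α β n : ℝ}
    (hup : ∀ X Y : ℝ, a * X ^ 2 + 2 * b * X * Y + c * Y ^ 2 ≤ X ^ 2 + Y ^ 2)
    (hlow : ∀ X Y : ℝ, m ^ 2 * (X ^ 2 + Y ^ 2) ≤
      (1 + ε) ^ 2 * (a * X ^ 2 + 2 * b * X * Y + c * Y ^ 2))
    (ha : a ≤ m ^ 2) (hm1 : m ≤ 1) (hm0 : 0 ≤ m) (hε : 0 < ε) (hε1 : ε ≤ 1)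
    (hα : α ^ 2 = σ * (1 + ε) ^ 2) (hβ : β ^ 2 = 1 - σ) (hσ : 1 ≤ 3 * n * σ)
    (hσ0 : 0 ≤ σ) (hn : 0 ≤ n)
    (h1 : 1 ≤ (1 + ε) ^ 2 * (a * α ^ 2 + 2 * b * α * β + c * β ^ 2)) :
    1 - m ^ 2 ≤ 102 * n * ε := by
  obtain ⟨κ, hκ⟩ : ∃ κ : ℝ, κ = 1 / (1 + ε) ^ 2 := ⟨_, rfl⟩
  have hκm : κ * (1 + ε) ^ 2 = 1 := by rw [hκ]; field_simp
  have hκ0 : 0 < κ := by rw [hκ]; positivity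
  have hκ1 : κ ≤ 1 := by
    rw [hκ, div_le_one (by positivity)]
    nlinarith
  have hκε : 1 - 2 * ε ≤ κ := by
    rw [hκ, le_div_iff₀ (by positivity)]
    nlinarith [sq_nonneg ε, mul_pos hε hε, mul_pos (mul_pos hε hε) hε]
  have hm2 : m ^ 2 ≤ 1 := by nlinarith
  have hmκ : 0 ≤ m ^ 2 * κ := by positivity
  obtain ⟨Λ, hΛ⟩ : ∃ Λ : ℝ, Λ = 1 - m ^ 2 * κ := ⟨_, rfl⟩
  have hΛm : 1 - m ^ 2 ≤ Λ := by nlinarith [sq_nonneg m]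
  have hΛ0 : 0 ≤ Λ := by linarith
  have hlow' : ∀ X Y : ℝ, κ * m ^ 2 * (X ^ 2 + Y ^ 2) ≤
      a * X ^ 2 + 2 * b * X * Y + c * Y ^ 2 := by
    intro X Y
    have := mul_le_mul_of_nonneg_left (hlow X Y) hκ0.le
    rw [← mul_assoc, ← mul_assoc, hκm, one_mul] at this
    exact this
  have hc1 : c ≤ 1 := by simpa using hup 0 1
  have hb : b ^ 2 ≤ (a - m ^ 2 * κ) * (c - m ^ 2 * κ) := sq_le_mul_of_forall_nonneg fun X Y => by
    have := hlow' X Y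
    linarith
  have ha0 : 0 ≤ a - m ^ 2 * κ := by
    have := hlow' 1 0
    nlinarith
  have ha2 : a - m ^ 2 * κ ≤ 2 * ε := by nlinarith [sq_nonneg m]
  have hb2 : b ^ 2 ≤ 2 * ε * Λ := by
    refine hb.trans ?_
    calc _ ≤ (a - m ^ 2 * κ) * Λ := by gcongr; linarith
      _ ≤ _ := by gcongr
  have h1' : κ ≤ a * α ^ 2 + 2 * b * α * β + c * β ^ 2 := by
    have := mul_le_mul_of_nonneg_left h1 hκ0.le
    rw [← mul_assoc, hκm, one_mul, mul_one] at this
    exact this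
  have hα4 : α ^ 2 ≤ 4 := by
    rw [hα]
    nlinarith [mul_nonneg hσ0 hε.le, mul_nonneg hσ0 (sq_nonneg ε)]
  have hασ : σ ≤ α ^ 2 := by
    rw [hα]
    nlinarith [mul_nonneg hσ0 hε.le, mul_nonneg hσ0 (sq_nonneg ε)]
  have hsum : α ^ 2 + β ^ 2 ≤ 1 + 3 * ε := by
    rw [hα, hβ]
    nlinarith [mul_nonneg hσ0 hε.le, mul_nonneg hσ0 (sq_nonneg ε)]
  have hβ1 : β ^ 2 ≤ 1 := by linarith
  have hcross : 2 * b * α * β ≤ α ^ 2 * Λ / 2 + 4 * ε := by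
    have h2 : (α * β * b) ^ 2 ≤ α ^ 2 * Λ * (2 * ε) := by
      calc (α * β * b) ^ 2 = α ^ 2 * β ^ 2 * b ^ 2 := by ring
        _ ≤ α ^ 2 * 1 * (2 * ε * Λ) := by gcongr
        _ = _ := by ring
    have h3 : (2 * b * α * β) ^ 2 ≤ (α ^ 2 * Λ / 2 + 4 * ε) ^ 2 := by
      generalize α ^ 2 * Λ = A at h2
      have h4 := sq_nonneg (A / 2 - 4 * ε)
      linarith
    exact (le_abs_self _).trans (abs_le_of_sq_le_sq h3 (by positivity))
  have hmain : α ^ 2 * (Λ - 2 * ε) ≤ 5 * ε + (α ^ 2 * Λ / 2 + 4 * ε) := by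
    have h2 : α ^ 2 * (Λ - 2 * ε) ≤ α ^ 2 * (1 - a) :=
      mul_le_mul_of_nonneg_left (by linarith) (sq_nonneg α)
    have h3 := mul_nonneg (sub_nonneg.2 hc1) (sq_nonneg β)
    linarith
  have h34 : α ^ 2 * Λ ≤ 34 * ε := by
    have := mul_le_mul_of_nonneg_right hα4 hε.le
    linarith
  have h35 : σ * Λ ≤ 34 * ε := le_trans (by gcongr) h34
  calc 1 - m ^ 2 ≤ 1 * Λ := by linarith
    _ ≤ 3 * n * σ * Λ := by gcongr
    _ = 3 * n * (σ * Λ) := by ring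
    _ ≤ 3 * n * (34 * ε) := by gcongr
    _ = _ := by ring

/-- A norm in John position all of whose planar sections are almost Euclidean is almost
Euclidean. -/
lemma norm_le_of_planar_sections {E : Type*} [NormedAddCommGroup E] [InnerProductSpace ℝ E]
    [FiniteDimensional ℝ E] (hdim : 2 ≤ Module.finrank ℝ E) {p : Seminorm ℝ E}
    (hp : Continuous p) (hple : ∀ x, p x ≤ ‖x‖)
    (hJ : ∀ x, ‖x‖ = 1 → ∀ s : ℝ, 0 ≤ s → ∃ y, ‖y‖ = 1 ∧
      1 + s ≤ p (y + (s * inner ℝ x y) • x) ^ Module.finrank ℝ E)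
    {ε : ℝ} (hε : 0 < ε)
    (hplane : ∀ ι : ℂ →ₗ[ℝ] E, Function.Injective ι →
      ∃ A : ℂ →ₗ[ℝ] ℂ, ∀ z, ‖A z‖ ≤ p (ι z) ∧ p (ι z) ≤ (1 + ε) * ‖A z‖) (x : E) :
    ‖x‖ ≤ (1 + 408 * (Module.finrank ℝ E : ℝ) ^ 2 * ε) * p x := by
  have hnt : Nontrivial E := Module.nontrivial_of_finrank_pos (R := ℝ) (by omega)
  obtain ⟨x₀, hx₀, hmin⟩ := exists_sphere_min hp
  set m := p x₀ with hm
  set d := Module.finrank ℝ E with hd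
  have hlow : 1 ≤ 2 * (d : ℝ) * m := john_position_lower_bound hple hx₀ (hJ x₀ hx₀)
  have hd2 : (2 : ℝ) ≤ d := by exact_mod_cast hdim
  have hm0 : 0 ≤ m := apply_nonneg p x₀
  have hmpos : 0 < m := by
    refine lt_of_le_of_ne hm0 fun h => ?_
    rw [← h] at hlow
    norm_num at hlow
  have hm1 : m ≤ 1 := (hple x₀).trans hx₀.le
  suffices h : 1 ≤ (1 + 408 * (d : ℝ) ^ 2 * ε) * m by
    calc ‖x‖ ≤ ((1 + 408 * (d : ℝ) ^ 2 * ε) * m) * ‖x‖ := by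
          nlinarith [norm_nonneg x]
      _ = (1 + 408 * (d : ℝ) ^ 2 * ε) * (m * ‖x‖) := by ring
      _ ≤ _ := by gcongr; exact hmin x
  by_cases hbig : 1 ≤ 204 * (d : ℝ) * ε
  · have h1 : 2 * (d : ℝ) ≤ 408 * (d : ℝ) ^ 2 * ε := by nlinarith
    calc 1 ≤ 2 * (d : ℝ) * m := hlow
      _ ≤ (1 + 408 * (d : ℝ) ^ 2 * ε) * m := by gcongr; linarith
  push Not at hbig
  have hε1 : ε ≤ 1 := by nlinarith
  have hcore : 1 - m ^ 2 ≤ 102 * d * ε := by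
    obtain ⟨y, hy, hpow⟩ := hJ x₀ hx₀ ε hε.le
    set t : ℝ := inner ℝ x₀ y with ht
    set w := y - t • x₀ with hw
    have hxw : inner ℝ x₀ w = 0 := by
      rw [hw, inner_sub_right, inner_smul_right, real_inner_self_eq_norm_sq, hx₀, ← ht]
      ring
    obtain ⟨z, β, hz, hxz, hβz⟩ : ∃ (z : E) (β : ℝ), ‖z‖ = 1 ∧ inner ℝ x₀ z = 0 ∧ w = β • z := by
      rcases eq_or_ne w 0 with h0 | h0
      · have : ∃ z ∈ (ℝ ∙ x₀)ᗮ, z ≠ 0 := by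
          refine Submodule.exists_mem_ne_zero_of_ne_bot fun hbot => ?_
          have h1 := (ℝ ∙ x₀).finrank_add_finrank_orthogonal
          rw [hbot, finrank_bot, finrank_span_singleton
            (by intro h; simp [h] at hx₀)] at h1
          omega
        obtain ⟨z, hz, hz0⟩ := this
        refine ⟨‖z‖⁻¹ • z, 0, ?_, ?_, by simp [h0]⟩
        · simp [norm_smul, hz0]
        · rw [inner_smul_right, Submodule.mem_orthogonal_singleton_iff_inner_right.1 hz, mul_zero]
      · have hn : ‖w‖ ≠ 0 := norm_ne_zero_iff.2 h0
        refine ⟨‖w‖⁻¹ • w, ‖w‖, ?_, ?_, ?_⟩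
        · simp [norm_smul, hn]
        · rw [inner_smul_right, hxw, mul_zero]
        · rw [smul_smul, mul_inv_cancel₀ hn, one_smul]
    have hnormsq : ∀ X Y : ℝ, ‖X • x₀ + Y • z‖ ^ 2 = X ^ 2 + Y ^ 2 := by
      intro X Y
      rw [norm_add_sq_real, norm_smul, norm_smul, inner_smul_left, inner_smul_right, hxz, hx₀, hz]
      simp
    have hyeq : y = t • x₀ + β • z := by rw [← hβz, hw]; abel
    have hβ2 : β ^ 2 = 1 - t ^ 2 := by
      have := hnormsq t β
      rw [← hyeq, hy] at this
      linarith
    set ι : ℂ →ₗ[ℝ] E := Complex.reLm.smulRight x₀ + Complex.imLm.smulRight z with hι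
    have hιapp : ∀ ζ : ℂ, ι ζ = ζ.re • x₀ + ζ.im • z := fun ζ => by simp [hι]
    have hιinj : Function.Injective ι := by
      rw [injective_iff_map_eq_zero]
      intro ζ hζ
      rw [hιapp] at hζ
      have := hnormsq ζ.re ζ.im
      rw [hζ, norm_zero] at this
      apply Complex.ext <;> simp <;> nlinarith [sq_nonneg ζ.re, sq_nonneg ζ.im]
    obtain ⟨A, hA⟩ := hplane ι hιinj
    have hAapp : ∀ X Y : ℝ, ‖A ⟨X, Y⟩‖ ^ 2 = ‖A 1‖ ^ 2 * X ^ 2 +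
        2 * (inner ℝ (A 1) (A Complex.I)) * X * Y + ‖A Complex.I‖ ^ 2 * Y ^ 2 := by
      intro X Y
      have : (⟨X, Y⟩ : ℂ) = X • (1 : ℂ) + Y • Complex.I := by
        apply Complex.ext <;> simp
      rw [this, map_add, map_smul, map_smul, norm_add_sq_real, norm_smul, norm_smul,
        inner_smul_left, inner_smul_right, mul_pow, mul_pow, Real.norm_eq_abs, Real.norm_eq_abs,
        sq_abs, sq_abs]
      simp
      ring
    have hpX : ∀ X Y : ℝ, p (ι ⟨X, Y⟩) ^ 2 ≤ X ^ 2 + Y ^ 2 := by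
      intro X Y
      rw [← hnormsq, hιapp]
      exact pow_le_pow_left₀ (apply_nonneg p _) (hple _) 2
    have hAp : ∀ X Y : ℝ, ‖A ⟨X, Y⟩‖ ^ 2 ≤ p (ι ⟨X, Y⟩) ^ 2 := fun X Y =>
      pow_le_pow_left₀ (norm_nonneg _) (hA _).1 2
    have hpA : ∀ X Y : ℝ, p (ι ⟨X, Y⟩) ^ 2 ≤ (1 + ε) ^ 2 * ‖A ⟨X, Y⟩‖ ^ 2 := fun X Y => by
      rw [← mul_pow]
      exact pow_le_pow_left₀ (apply_nonneg p _) (hA _).2 2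
    have hyD : y + (ε * t) • x₀ = ι ⟨t * (1 + ε), β⟩ := by
      rw [hιapp, hyeq]
      simp only
      module
    rw [hyD] at hpow
    have hpone : 1 ≤ p (ι ⟨t * (1 + ε), β⟩) := by
      by_contra! hlt
      have := pow_le_one₀ (n := d) (apply_nonneg p (ι ⟨t * (1 + ε), β⟩)) hlt.le
      linarith
    refine planar_form_estimate (σ := t ^ 2) (α := t * (1 + ε)) (β := β)
      (a := ‖A 1‖ ^ 2) (b := inner ℝ (A 1) (A Complex.I)) (c := ‖A Complex.I‖ ^ 2)
      (fun X Y => ?_) (fun X Y => ?_) ?_ hm1 hm0 hε hε1 (by ring) hβ2 ?_ (sq_nonneg t)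
      (by positivity) ?_
    · rw [← hAapp]
      exact (hAp X Y).trans (hpX X Y)
    · rw [← hAapp, ← hnormsq, ← mul_pow]
      refine le_trans ?_ (hpA X Y)
      rw [hιapp]
      exact pow_le_pow_left₀ (by positivity) (hmin _) 2
    · have h1 := (hA 1).1
      rw [hιapp] at h1
      simp only [Complex.one_re, Complex.one_im, one_smul, zero_smul, add_zero] at h1
      exact pow_le_pow_left₀ (norm_nonneg _) h1 2
    · by_contra! hlt
      have h1 := hpX (t * (1 + ε)) β
      have h2 : (t * (1 + ε)) ^ 2 + β ^ 2 ≤ 1 + 3 * ε * t ^ 2 := by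
        rw [hβ2]
        have := mul_nonneg (mul_nonneg (sq_nonneg t) hε.le) (sub_nonneg.2 hε1)
        linarith
      have h3 : (1 + ε) ^ 2 ≤ (1 + 3 * ε * t ^ 2) ^ d := by
        calc (1 + ε) ^ 2 ≤ (p (ι ⟨t * (1 + ε), β⟩) ^ d) ^ 2 :=
              pow_le_pow_left₀ (by positivity) hpow 2
          _ = (p (ι ⟨t * (1 + ε), β⟩) ^ 2) ^ d := pow_right_comm _ _ _
          _ ≤ _ := pow_le_pow_left₀ (by positivity) (h1.trans h2) d
      have h4 : (1 + 3 * ε * t ^ 2) ^ d ≤ Real.exp ε := by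
        calc (1 + 3 * ε * t ^ 2) ^ d ≤ Real.exp (3 * ε * t ^ 2) ^ d := by
              gcongr
              rw [add_comm]
              exact Real.add_one_le_exp _
          _ = Real.exp (ε * (3 * d * t ^ 2)) := by
              rw [← Real.exp_nat_mul]
              congr 1
              ring
          _ ≤ Real.exp ε := by
              rw [Real.exp_le_exp]
              nlinarith
      have h5 := Real.abs_exp_sub_one_sub_id_le (x := ε) (by rw [abs_of_pos hε]; exact hε1)
      have h6 := (abs_le.1 h5).2
      nlinarith
    · rw [← hAapp]
      refine le_trans ?_ (hpA _ _)
      exact one_le_pow₀ hpone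
  have hm2 : 1 / 2 ≤ m ^ 2 := by linarith
  have hmm : m ^ 2 ≤ m := by nlinarith
  have hu0 : 0 ≤ (d : ℝ) * ε := by positivity
  have h1 : 1 ≤ (1 + 204 * (d * ε)) * m := by nlinarith
  refine h1.trans ?_
  gcongr ?_ * m
  have : (d : ℝ) * ε ≤ d ^ 2 * ε := by
    gcongr
    nlinarith
  linarith

/-- The Dirichlet-type sum whose squared modulus is (a multiple of) the Fejér kernel. -/
noncomputable def unitGeomSum (N : ℕ) (t : ℝ) : ℂ :=
  ∑ j ∈ Finset.range N, Complex.exp (t * Complex.I) ^ j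

lemma continuous_unitGeomSum (N : ℕ) : Continuous (unitGeomSum N) := by
  unfold unitGeomSum
  fun_prop

lemma norm_unitGeomSum_mul_le (N : ℕ) (t : ℝ) :
    ‖unitGeomSum N t‖ * ‖Complex.exp (t * Complex.I) - 1‖ ≤ 2 := by
  rw [← norm_mul, unitGeomSum, geom_sum_mul]
  refine (norm_sub_le _ _).trans ?_
  rw [norm_pow, Complex.norm_exp_ofReal_mul_I]
  norm_num

lemma normSq_unitGeomSum (N : ℕ) (t θ : ℝ) :
    ((‖unitGeomSum N (t - θ)‖ ^ 2 : ℝ) : ℂ) = ∑ j ∈ Finset.range N, ∑ l ∈ Finset.range N,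
      Complex.exp (((j - l : ℤ) : ℂ) * t * Complex.I) *
        Complex.exp (-(((j - l : ℤ) : ℂ) * θ * Complex.I)) := by
  push_cast
  rw [← Complex.mul_conj', unitGeomSum, map_sum, Finset.sum_mul_sum]
  refine Finset.sum_congr rfl fun j _ => Finset.sum_congr rfl fun l _ => ?_
  rw [map_pow, ← Complex.exp_conj, ← Complex.exp_nat_mul, ← Complex.exp_nat_mul, ← Complex.exp_add,
    ← Complex.exp_add]
  congr 1
  simp
  ring

lemma abs_fejer_integral_sub_le {g : ℝ → ℝ} (hg : Continuous g) {η : ℝ} (hη : 0 ≤ η)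
    (hcoef : ∀ k : ℤ, k ≠ 0 →
      ‖∫ t in (0 : ℝ)..2 * Real.pi, Complex.exp (k * t * Complex.I) * (g t : ℂ)‖ ≤ η)
    (N : ℕ) (θ : ℝ) :
    |(∫ t in (0 : ℝ)..2 * Real.pi, ‖unitGeomSum N (t - θ)‖ ^ 2 * g t) -
      N * ∫ t in (0 : ℝ)..2 * Real.pi, g t| ≤ N ^ 2 * η := by
  set a : ℤ → ℂ := fun k => ∫ t in (0 : ℝ)..2 * Real.pi, Complex.exp (k * t * Complex.I) * (g t : ℂ)
    with ha
  have hI : (((∫ t in (0 : ℝ)..2 * Real.pi, ‖unitGeomSum N (t - θ)‖ ^ 2 * g t) : ℝ) : ℂ) =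
      ∑ j ∈ Finset.range N, ∑ l ∈ Finset.range N,
        Complex.exp (-(((j - l : ℤ) : ℂ) * θ * Complex.I)) * a (j - l) := by
    rw [← intervalIntegral.integral_ofReal]
    have : ∀ t : ℝ, ((‖unitGeomSum N (t - θ)‖ ^ 2 * g t : ℝ) : ℂ) =
        ∑ j ∈ Finset.range N, ∑ l ∈ Finset.range N,
          Complex.exp (-(((j - l : ℤ) : ℂ) * θ * Complex.I)) *
            (Complex.exp (((j - l : ℤ) : ℂ) * t * Complex.I) * (g t : ℂ)) := by
      intro t
      rw [Complex.ofReal_mul, normSq_unitGeomSum, Finset.sum_mul]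
      refine Finset.sum_congr rfl fun j _ => ?_
      rw [Finset.sum_mul]
      refine Finset.sum_congr rfl fun l _ => ?_
      ring
    simp_rw [this]
    rw [intervalIntegral.integral_finsetSum fun j _ =>
      (Continuous.intervalIntegrable (by fun_prop) _ _)]
    refine Finset.sum_congr rfl fun j _ => ?_
    rw [intervalIntegral.integral_finsetSum fun l _ =>
      (Continuous.intervalIntegrable (by fun_prop) _ _)]
    refine Finset.sum_congr rfl fun l _ => ?_
    rw [intervalIntegral.integral_const_mul]
  have ha0 : a 0 = ((∫ t in (0 : ℝ)..2 * Real.pi, g t : ℝ) : ℂ) := by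
    rw [ha, ← intervalIntegral.integral_ofReal]
    simp
  have hN : (N : ℂ) * a 0 = ∑ j ∈ Finset.range N, ∑ l ∈ Finset.range N,
      if j = l then a 0 else 0 := by
    simp only [Finset.sum_ite_eq, Finset.mem_range]
    rw [Finset.sum_congr rfl (fun x hx => if_pos (Finset.mem_range.1 hx))]
    simp
  rw [← Real.norm_eq_abs, ← Complex.norm_real, Complex.ofReal_sub, Complex.ofReal_mul, ← ha0, hI,
    Complex.ofReal_natCast, hN, ← Finset.sum_sub_distrib]
  refine (norm_sum_le _ _).trans ?_
  calc _ ≤ ∑ j ∈ Finset.range N, ∑ l ∈ Finset.range N, η := by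
        refine Finset.sum_le_sum fun j _ => ?_
        rw [← Finset.sum_sub_distrib]
        refine (norm_sum_le _ _).trans (Finset.sum_le_sum fun l _ => ?_)
        split_ifs with h
        · simpa [h] using hη
        · have hjl : (j : ℤ) - l ≠ 0 := sub_ne_zero.2 (by exact_mod_cast h)
          have := hcoef _ hjl
          rw [sub_zero, norm_mul]
          rw [show -(((j - l : ℤ) : ℂ) * θ * Complex.I) =
            ((-((j - l : ℤ) * θ) : ℝ) : ℂ) * Complex.I by push_cast; ring,
            Complex.norm_exp_ofReal_mul_I, one_mul]
          exact this
    _ = N ^ 2 * η := by simp; ring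

lemma integral_exp_int_mul_I {k : ℤ} (hk : k ≠ 0) :
    ∫ t in (0 : ℝ)..2 * Real.pi, Complex.exp (k * t * Complex.I) = 0 := by
  have hk' : (k : ℂ) * Complex.I ≠ 0 := by simp [hk]
  have h : ∀ t : ℝ, Complex.exp (k * t * Complex.I) = Complex.exp (k * Complex.I * t) := fun t => by
    congr 1
    ring
  simp_rw [h]
  rw [integral_exp_mul_complex hk']
  have : (k : ℂ) * Complex.I * ((2 * Real.pi : ℝ) : ℂ) = k * (2 * Real.pi * Complex.I) := by
    push_cast
    ring
  rw [this, Complex.exp_int_mul_two_pi_mul_I]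
  simp

lemma integral_normSq_unitGeomSum (N : ℕ) (θ : ℝ) :
    ∫ t in (0 : ℝ)..2 * Real.pi, ‖unitGeomSum N (t - θ)‖ ^ 2 = 2 * Real.pi * N := by
  have h := abs_fejer_integral_sub_le (g := fun _ => 1) continuous_const le_rfl
    (fun k hk => by simp [integral_exp_int_mul_I hk]) N θ
  simp only [mul_one, mul_zero, abs_nonpos_iff, sub_eq_zero] at h
  rw [h]
  simp
  ring

/-- A Lipschitz function on the circle all of whose nonconstant Fourier coefficients are small is
close to its mean. -/
lemma abs_sub_mean_le {f : ℂ → ℝ} {L : ℝ} (hL : 0 ≤ L) (hf : Continuous f)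
    (hlip : ∀ z w, |f z - f w| ≤ L * ‖z - w‖) {η : ℝ} (hη : 0 ≤ η)
    (hcoef : ∀ k : ℤ, k ≠ 0 → ‖∫ t in (0 : ℝ)..2 * Real.pi,
      Complex.exp (k * t * Complex.I) * (f (Complex.exp (t * Complex.I)) : ℂ)‖ ≤ η)
    {N : ℕ} (hN : 0 < N) (θ : ℝ) :
    |2 * Real.pi * f (Complex.exp (θ * Complex.I)) -
      ∫ t in (0 : ℝ)..2 * Real.pi, f (Complex.exp (t * Complex.I))| ≤
        N * η + 4 * Real.pi * L / Real.sqrt N := by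
  have hN' : (0 : ℝ) < N := by exact_mod_cast hN
  have hsN : 0 < Real.sqrt N := Real.sqrt_pos.2 hN'
  have hpi := Real.pi_pos
  set fθ := f (Complex.exp (θ * Complex.I)) with hfθ
  have hD := (continuous_unitGeomSum N)
  have h1 := abs_fejer_integral_sub_le (g := fun t : ℝ => f (Complex.exp (t * Complex.I)))
    (by fun_prop) hη hcoef N θ
  have hI := integral_normSq_unitGeomSum N θ
  have h2 : |(∫ t in (0 : ℝ)..2 * Real.pi,
      ‖unitGeomSum N (t - θ)‖ ^ 2 * f (Complex.exp (t * Complex.I))) - 2 * Real.pi * N * fθ| ≤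
        4 * Real.pi * L * Real.sqrt N := by
    rw [← hI, ← intervalIntegral.integral_mul_const, ← intervalIntegral.integral_sub
      (Continuous.intervalIntegrable (by fun_prop) _ _)
      (Continuous.intervalIntegrable (by fun_prop) _ _)]
    refine (intervalIntegral.abs_integral_le_integral_abs (by positivity)).trans ?_
    calc _ ≤ ∫ t in (0 : ℝ)..2 * Real.pi,
          L * ((1 / Real.sqrt N) * ‖unitGeomSum N (t - θ)‖ ^ 2 + Real.sqrt N) := by
          refine intervalIntegral.integral_mono_on (by positivity)
            (Continuous.intervalIntegrable (by fun_prop) _ _)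
            (Continuous.intervalIntegrable (by fun_prop) _ _) fun t _ => ?_
          rw [← mul_sub, abs_mul, abs_of_nonneg (sq_nonneg _)]
          set D := ‖unitGeomSum N (t - θ)‖ with hDdef
          have hD0 : 0 ≤ D := norm_nonneg _
          have h3 := hlip (Complex.exp (t * Complex.I)) (Complex.exp (θ * Complex.I))
          have h4 : ‖Complex.exp (t * Complex.I) - Complex.exp (θ * Complex.I)‖ =
              ‖Complex.exp ((t - θ : ℝ) * Complex.I) - 1‖ := by
            have : Complex.exp (t * Complex.I) - Complex.exp (θ * Complex.I) =
                (Complex.exp ((t - θ : ℝ) * Complex.I) - 1) * Complex.exp (θ * Complex.I) := by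
              rw [sub_mul, one_mul, ← Complex.exp_add]
              congr 2
              push_cast
              ring
            rw [this, norm_mul, Complex.norm_exp_ofReal_mul_I, mul_one]
          have h5 := norm_unitGeomSum_mul_le N (t - θ)
          rw [← h4, ← hDdef] at h5
          have h6 : 2 * D ≤ 1 / Real.sqrt N * D ^ 2 + Real.sqrt N := by
            have : 1 / Real.sqrt N * D ^ 2 + Real.sqrt N - 2 * D =
                1 / Real.sqrt N * (D - Real.sqrt N) ^ 2 := by
              field_simp
              ring
            have h7 : 0 ≤ 1 / Real.sqrt N * (D - Real.sqrt N) ^ 2 := by positivity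
            linarith
          calc D ^ 2 * |f (Complex.exp (t * Complex.I)) - fθ|
              ≤ D ^ 2 * (L * ‖Complex.exp (t * Complex.I) - Complex.exp (θ * Complex.I)‖) := by
                gcongr
            _ = L * (D * (D * ‖Complex.exp (t * Complex.I) - Complex.exp (θ * Complex.I)‖)) := by
                ring
            _ ≤ L * (D * 2) := by gcongr
            _ ≤ _ := by
                gcongr
                linarith
      _ = 4 * Real.pi * L * Real.sqrt N := by
          rw [intervalIntegral.integral_const_mul, intervalIntegral.integral_add
            (Continuous.intervalIntegrable (by fun_prop) _ _)
            (Continuous.intervalIntegrable (by fun_prop) _ _),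
            intervalIntegral.integral_const_mul, hI]
          have hs : Real.sqrt N * Real.sqrt N = N := Real.mul_self_sqrt hN'.le
          simp only [intervalIntegral.integral_const, sub_zero, smul_eq_mul]
          rw [show 1 / Real.sqrt N * (2 * Real.pi * N) = 2 * Real.pi * Real.sqrt N by
            field_simp
            linarith]
          ring
  set c := ∫ t in (0 : ℝ)..2 * Real.pi, f (Complex.exp (t * Complex.I)) with hc
  have h3 : |N * (2 * Real.pi * fθ - c)| ≤ N ^ 2 * η + 4 * Real.pi * L * Real.sqrt N := by
    rw [abs_le] at h1 h2 ⊢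
    constructor <;> linarith [h1.1, h1.2, h2.1, h2.2]
  rw [abs_mul, abs_of_pos hN'] at h3
  have h4 : N * (N * η + 4 * Real.pi * L / Real.sqrt N) =
      N ^ 2 * η + 4 * Real.pi * L * Real.sqrt N := by
    have hs : Real.sqrt N * Real.sqrt N = N := Real.mul_self_sqrt hN'.le
    field_simp
    linear_combination -(4 * Real.pi * L) * hs
  rw [← h4] at h3
  exact le_of_mul_le_mul_left h3 hN'

/-- The total mass of the tent function `y ↦ max (1 - N y) 0` of a planar norm. -/
noncomputable def planarMass (N : Seminorm ℝ ℂ) : ℝ := ∫ y, max (1 - N y) 0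

/-- The second moment of the tent function of `N` about the line spanned by `x`. -/
noncomputable def planarMoment (N : Seminorm ℝ ℂ) (x : ℂ) : ℝ :=
  ∫ y : ℂ, (x.re * y.im - x.im * y.re) ^ 2 * max (1 - N y) 0

/-- A quadratic form attached to a planar norm equivariantly under linear changes of variable. -/
noncomputable def planarForm (N : Seminorm ℝ ℂ) (x : ℂ) : ℝ :=
  planarMoment N x / planarMass N ^ 3

/-- The off-diagonal coefficient of `planarForm`. -/
noncomputable def planarCross (N : Seminorm ℝ ℂ) : ℝ :=
  -(∫ y : ℂ, y.re * y.im * max (1 - N y) 0) / planarMass N ^ 3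

lemma max_one_sub_eq_zero {N : Seminorm ℝ ℂ} {m : ℝ} (hm : 0 < m) (hmN : ∀ x, m * ‖x‖ ≤ N x)
    {y : ℂ} (hy : y ∉ closedBall (0 : ℂ) m⁻¹) : max (1 - N y) 0 = 0 := by
  rw [mem_closedBall_zero_iff, not_le] at hy
  refine max_eq_right ?_
  have h1 := hmN y
  have h2 : m * m⁻¹ < m * ‖y‖ := mul_lt_mul_of_pos_left hy hm
  rw [mul_inv_cancel₀ hm.ne'] at h2
  linarith

lemma hasCompactSupport_mul_tent {N : Seminorm ℝ ℂ} (hN : Continuous N)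
    (hN0 : ∀ x, N x = 0 → x = 0) (h : ℂ → ℝ) :
    HasCompactSupport fun y => h y * max (1 - N y) 0 := by
  obtain ⟨m, hm, hmN⟩ := exists_pos_mul_norm_le hN hN0
  refine HasCompactSupport.of_support_subset_isCompact (isCompact_closedBall (0 : ℂ) m⁻¹) ?_
  intro y hy
  by_contra hy'
  exact hy (by simp only [max_one_sub_eq_zero hm hmN hy', mul_zero])

lemma integrable_mul_tent {N : Seminorm ℝ ℂ} (hN : Continuous N)
    (hN0 : ∀ x, N x = 0 → x = 0) {h : ℂ → ℝ} (hh : Continuous h) :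
    MeasureTheory.Integrable fun y => h y * max (1 - N y) 0 :=
  Continuous.integrable_of_hasCompactSupport (by fun_prop) (hasCompactSupport_mul_tent hN hN0 h)

lemma integrable_tent {N : Seminorm ℝ ℂ} (hN : Continuous N)
    (hN0 : ∀ x, N x = 0 → x = 0) : MeasureTheory.Integrable fun y => max (1 - N y) 0 := by
  simpa using integrable_mul_tent hN hN0 (h := fun _ => 1) continuous_const

lemma integral_mul_tent_pos {N : Seminorm ℝ ℂ} (hN : Continuous N)
    (hN0 : ∀ x, N x = 0 → x = 0) {h : ℂ → ℝ} (hh : Continuous h) (h0 : ∀ y, 0 ≤ h y)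
    {y₀ : ℂ} (hy₀ : ∀ t : ℝ, 0 < t → 0 < h (t • y₀)) :
    0 < ∫ y, h y * max (1 - N y) 0 := by
  obtain ⟨t, ht, hty⟩ : ∃ t : ℝ, 0 < t ∧ N (t • y₀) < 1 := by
    refine ⟨(N y₀ + 1)⁻¹, by positivity, ?_⟩
    have : 0 < N y₀ + 1 := by positivity
    rw [map_smul_eq_mul, Real.norm_of_nonneg (by positivity), inv_mul_lt_iff₀ this]
    linarith
  refine Continuous.integral_pos_of_hasCompactSupport_nonneg_nonzero (x := t • y₀) (by fun_prop)
    (hasCompactSupport_mul_tent hN hN0 h) (fun y => mul_nonneg (h0 y) (le_max_right _ _)) ?_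
  have h1 : 0 < max (1 - N (t • y₀)) 0 := lt_max_of_lt_left (by linarith)
  exact (mul_pos (hy₀ t ht) h1).ne'

lemma planarMass_pos {N : Seminorm ℝ ℂ} (hN : Continuous N) (hN0 : ∀ x, N x = 0 → x = 0) :
    0 < planarMass N := by
  simpa [planarMass] using integral_mul_tent_pos hN hN0 (h := fun _ => 1) continuous_const
    (fun _ => zero_le_one) (y₀ := 0) (fun _ _ => one_pos)

lemma planarMoment_pos {N : Seminorm ℝ ℂ} (hN : Continuous N) (hN0 : ∀ x, N x = 0 → x = 0)
    {x : ℂ} (hx : x ≠ 0) : 0 < planarMoment N x := by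
  refine integral_mul_tent_pos hN hN0 (by fun_prop) (fun _ => sq_nonneg _)
    (y₀ := Complex.I * x) fun t ht => ?_
  have h1 : 0 < Complex.normSq x := Complex.normSq_pos.2 hx
  rw [Complex.normSq_apply] at h1
  have h2 : x.re * (t • (Complex.I * x)).im - x.im * (t • (Complex.I * x)).re =
      t * (x.re * x.re + x.im * x.im) := by
    simp
    ring
  rw [h2]
  positivity

lemma planarForm_pos {N : Seminorm ℝ ℂ} (hN : Continuous N) (hN0 : ∀ x, N x = 0 → x = 0)
    {x : ℂ} (hx : x ≠ 0) : 0 < planarForm N x :=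
  div_pos (planarMoment_pos hN hN0 hx) (pow_pos (planarMass_pos hN hN0) 3)

lemma planarForm_apply {N : Seminorm ℝ ℂ} (hN : Continuous N) (hN0 : ∀ x, N x = 0 → x = 0)
    (x : ℂ) : planarForm N x = planarForm N 1 * x.re ^ 2 +
      2 * planarCross N * x.re * x.im +
      planarForm N Complex.I * x.im ^ 2 := by
  have h1 : planarMoment N x = x.re ^ 2 * planarMoment N 1 +
      (-2 * x.re * x.im) * (∫ y : ℂ, y.re * y.im * max (1 - N y) 0) +
      x.im ^ 2 * planarMoment N Complex.I := by
    simp only [planarMoment]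
    have i1 := (integrable_mul_tent hN hN0
      (h := fun y => ((1 : ℂ).re * y.im - (1 : ℂ).im * y.re) ^ 2) (by fun_prop)).const_mul (x.re ^ 2)
    have i2 := (integrable_mul_tent hN hN0
      (h := fun y => y.re * y.im) (by fun_prop)).const_mul (-2 * x.re * x.im)
    have i3 := (integrable_mul_tent hN hN0
      (h := fun y => (Complex.I.re * y.im - Complex.I.im * y.re) ^ 2)
      (by fun_prop)).const_mul (x.im ^ 2)
    rw [← MeasureTheory.integral_const_mul, ← MeasureTheory.integral_const_mul,
      ← MeasureTheory.integral_const_mul, ← MeasureTheory.integral_add i1 i2]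
    have i4 := MeasureTheory.integral_add (i1.add i2) i3
    simp only [Pi.add_apply] at i4
    rw [← i4]
    congr 1
    funext y
    simp
    ring
  simp only [planarForm, planarCross]
  rw [h1]
  ring

lemma integral_comp_linearEquiv (T : ℂ ≃ₗ[ℝ] ℂ) (g : ℂ → ℝ) :
    ∫ y, g (T y) = |(LinearMap.det (T : ℂ →ₗ[ℝ] ℂ))⁻¹| * ∫ y, g y := by
  have hT : LinearMap.det (T : ℂ →ₗ[ℝ] ℂ) ≠ 0 := (LinearEquiv.isUnit_det' T).ne_zero
  have h := MeasureTheory.Measure.map_linearMap_addHaar_eq_smul_addHaar MeasureTheory.volume hT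
  have he : MeasurableEmbedding T :=
    T.toContinuousLinearEquiv.toHomeomorph.measurableEmbedding
  rw [← he.integral_map g]
  have : (⇑T : ℂ → ℂ) = ⇑(T : ℂ →ₗ[ℝ] ℂ) := rfl
  rw [this, h, MeasureTheory.integral_smul_measure, ENNReal.toReal_ofReal (abs_nonneg _),
    smul_eq_mul]

lemma planarMass_comp (N : Seminorm ℝ ℂ) (T : ℂ ≃ₗ[ℝ] ℂ) :
    planarMass (N.comp (T : ℂ →ₗ[ℝ] ℂ)) =
      |(LinearMap.det (T : ℂ →ₗ[ℝ] ℂ))⁻¹| * planarMass N :=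
  integral_comp_linearEquiv T fun y => max (1 - N y) 0

lemma det_mul_cross (T : ℂ →ₗ[ℝ] ℂ) (x y : ℂ) :
    LinearMap.det T * (x.re * y.im - x.im * y.re) =
      (T x).re * (T y).im - (T x).im * (T y).re := by
  have hdet : LinearMap.det T =
      (T 1).re * (T Complex.I).im - (T 1).im * (T Complex.I).re := by
    rw [← LinearMap.det_toMatrix Complex.basisOneI, Matrix.det_fin_two]
    simp [LinearMap.toMatrix_apply]
    ring
  have hT : ∀ z : ℂ, T z = z.re • T 1 + z.im • T Complex.I := fun z => by
    rw [← map_smul, ← map_smul, ← map_add]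
    congr 1
    apply Complex.ext <;> simp
  rw [hdet, hT x, hT y]
  simp
  ring

lemma planarMoment_comp (N : Seminorm ℝ ℂ) (T : ℂ ≃ₗ[ℝ] ℂ) (x : ℂ) :
    planarMoment (N.comp (T : ℂ →ₗ[ℝ] ℂ)) x =
      |(LinearMap.det (T : ℂ →ₗ[ℝ] ℂ))⁻¹| ^ 3 * planarMoment N (T x) := by
  set d := LinearMap.det (T : ℂ →ₗ[ℝ] ℂ) with hd
  have hd0 : d ≠ 0 := (LinearEquiv.isUnit_det' T).ne_zero
  have h := integral_comp_linearEquiv T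
    fun y => ((T x).re * y.im - (T x).im * y.re) ^ 2 * max (1 - N y) 0
  rw [← hd] at h
  rw [planarMoment, planarMoment, pow_succ, mul_assoc, ← h, sq_abs,
    ← MeasureTheory.integral_const_mul]
  congr 1
  funext y
  have h1 := det_mul_cross (T : ℂ →ₗ[ℝ] ℂ) x y
  simp only [LinearEquiv.coe_coe, ← hd] at h1
  rw [← h1]
  simp only [Seminorm.comp_apply, LinearEquiv.coe_coe]
  field_simp

lemma planarForm_comp (N : Seminorm ℝ ℂ) (T : ℂ ≃ₗ[ℝ] ℂ) (x : ℂ) :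
    planarForm (N.comp (T : ℂ →ₗ[ℝ] ℂ)) x = planarForm N (T x) := by
  have hd0 : |(LinearMap.det (T : ℂ →ₗ[ℝ] ℂ))⁻¹| ≠ 0 :=
    abs_ne_zero.2 (inv_ne_zero (LinearEquiv.isUnit_det' T).ne_zero)
  rw [planarForm, planarForm, planarMass_comp, planarMoment_comp, mul_pow,
    mul_div_mul_left _ _ (pow_ne_zero 3 hd0)]

lemma planarMoment_smul (N : Seminorm ℝ ℂ) (r : ℝ) (x : ℂ) :
    planarMoment N (r • x) = r ^ 2 * planarMoment N x := by
  rw [planarMoment, planarMoment, ← MeasureTheory.integral_const_mul]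
  congr 1
  funext y
  simp
  ring

lemma planarForm_smul (N : Seminorm ℝ ℂ) (r : ℝ) (x : ℂ) :
    planarForm N (r • x) = r ^ 2 * planarForm N x := by
  rw [planarForm, planarForm, planarMoment_smul, mul_div_assoc]

lemma planarMass_anti {N N' : Seminorm ℝ ℂ} (hN : Continuous N) (hN0 : ∀ x, N x = 0 → x = 0)
    (hN' : Continuous N') (h : ∀ z, N z ≤ N' z) : planarMass N' ≤ planarMass N := by
  refine MeasureTheory.integral_mono (integrable_tent hN' fun x hx => hN0 x ?_)
    (integrable_tent hN hN0) fun y => ?_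
  · exact le_antisymm (hx ▸ h x) (apply_nonneg N x)
  · exact max_le_max (by linarith [h y]) le_rfl

lemma planarMoment_anti {N N' : Seminorm ℝ ℂ} (hN : Continuous N) (hN0 : ∀ x, N x = 0 → x = 0)
    (hN' : Continuous N') (h : ∀ z, N z ≤ N' z) (x : ℂ) :
    planarMoment N' x ≤ planarMoment N x := by
  refine MeasureTheory.integral_mono (integrable_mul_tent hN' (fun x hx => hN0 x ?_) (by fun_prop))
    (integrable_mul_tent hN hN0 (by fun_prop)) fun y => ?_
  · exact le_antisymm (hx ▸ h x) (apply_nonneg N x)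
  · exact mul_le_mul_of_nonneg_left (max_le_max (by linarith [h y]) le_rfl) (sq_nonneg _)

lemma continuous_seminorm_comp {E F : Type*} [NormedAddCommGroup E] [NormedSpace ℝ E]
    [FiniteDimensional ℝ E] [NormedAddCommGroup F] [NormedSpace ℝ F] {p : Seminorm ℝ F}
    (hp : Continuous p) (T : E →ₗ[ℝ] F) : Continuous (p.comp T) :=
  hp.comp T.continuous_of_finiteDimensional

lemma definite_seminorm_comp {E F : Type*} [AddCommGroup E] [Module ℝ E] [AddCommGroup F]
    [Module ℝ F] {p : Seminorm ℝ F} (hp0 : ∀ x, p x = 0 → x = 0) {T : E →ₗ[ℝ] F}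
    (hT : Function.Injective T) (x : E) (hx : p.comp T x = 0) : x = 0 :=
  hT ((hp0 _ hx).trans (map_zero T).symm)

/-- Stability of the planar form under perturbation of the norm. -/
lemma planarForm_stable {N N' : Seminorm ℝ ℂ} (hN : Continuous N) (hN0 : ∀ x, N x = 0 → x = 0)
    (hN' : Continuous N') {r : ℝ} (hr : 0 < r) (h1 : ∀ z, N z ≤ N' z)
    (h2 : ∀ z, N' z ≤ r * N z) (x : ℂ) :
    planarForm N x ≤ r ^ 4 * planarForm N' x ∧ planarForm N' x ≤ r ^ 6 * planarForm N x := by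
  have hN0' : ∀ x, N' x = 0 → x = 0 := fun x hx =>
    hN0 x (le_antisymm (hx ▸ h1 x) (apply_nonneg N x))
  set T : ℂ ≃ₗ[ℝ] ℂ := LinearEquiv.smulOfNeZero ℝ ℂ r hr.ne' with hT
  have hTz : ∀ z, T z = r • z := fun z => rfl
  have hdet : |(LinearMap.det (T : ℂ →ₗ[ℝ] ℂ))⁻¹| = (r ^ 2)⁻¹ := by
    have : (T : ℂ →ₗ[ℝ] ℂ) = r • LinearMap.id := by
      ext z <;> simp [hTz]
    rw [this, LinearMap.det_smul, LinearMap.det_id, Complex.finrank_real_complex, mul_one,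
      abs_of_pos (by positivity)]
  have hc := continuous_seminorm_comp hN (T : ℂ →ₗ[ℝ] ℂ)
  have hle : ∀ z, N' z ≤ N.comp (T : ℂ →ₗ[ℝ] ℂ) z := fun z => by
    rw [Seminorm.comp_apply, LinearEquiv.coe_coe, hTz, map_smul_eq_mul, Real.norm_of_nonneg hr.le]
    exact h2 z
  have a1 := planarMass_anti hN hN0 hN' h1
  have a2 := planarMass_anti hN' hN0' hc hle
  have s1 := planarMoment_anti hN hN0 hN' h1 x
  have s2 := planarMoment_anti hN' hN0' hc hle x
  rw [planarMass_comp, hdet] at a2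
  rw [planarMoment_comp, hdet, hTz, planarMoment_smul] at s2
  have pA := planarMass_pos hN hN0
  have pA' := planarMass_pos hN' hN0'
  have pS' : 0 ≤ planarMoment N' x :=
    MeasureTheory.integral_nonneg fun y => mul_nonneg (sq_nonneg _) (le_max_right _ _)
  have pS : 0 ≤ planarMoment N x := pS'.trans s1
  simp only [planarForm]
  constructor
  · rw [← mul_div_assoc, div_le_div_iff₀ (by positivity) (by positivity)]
    have : planarMoment N x ≤ r ^ 4 * planarMoment N' x := by
      calc planarMoment N x = r ^ 4 * ((r ^ 2)⁻¹ ^ 3 * (r ^ 2 * planarMoment N x)) := by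
            field_simp
        _ ≤ _ := by gcongr
    calc planarMoment N x * planarMass N' ^ 3 ≤
        (r ^ 4 * planarMoment N' x) * planarMass N ^ 3 := by gcongr
      _ = _ := by ring
  · rw [← mul_div_assoc, div_le_div_iff₀ (by positivity) (by positivity)]
    have : planarMass N ≤ r ^ 2 * planarMass N' := by
      calc planarMass N = r ^ 2 * ((r ^ 2)⁻¹ * planarMass N) := by field_simp
        _ ≤ _ := by gcongr
    calc _ ≤ planarMoment N x * (r ^ 2 * planarMass N') ^ 3 := by gcongr
      _ = _ := by ring

lemma exists_planarForm_norm : ∃ κ : ℝ, 0 < κ ∧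
    ∀ x, planarForm (normSeminorm ℝ ℂ) x = κ * ‖x‖ ^ 2 := by
  have hc : Continuous (normSeminorm ℝ ℂ) := continuous_norm
  have h0 : ∀ x, normSeminorm ℝ ℂ x = 0 → x = 0 := fun x hx => norm_eq_zero.1 hx
  refine ⟨planarForm (normSeminorm ℝ ℂ) 1, planarForm_pos hc h0 one_ne_zero, fun x => ?_⟩
  rcases eq_or_ne x 0 with rfl | hx
  · have := planarForm_smul (normSeminorm ℝ ℂ) 0 1
    simp at this
    simp [this]
  have hx' : ‖x‖ ≠ 0 := norm_ne_zero_iff.2 hx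
  set T : ℂ ≃ₗ[ℝ] ℂ := LinearEquiv.smulOfNeZero ℝ ℂ ‖x‖ hx'
  set M : ℂ ≃ₗ[ℝ] ℂ := (LinearEquiv.smulOfNeZero ℂ ℂ x hx).restrictScalars ℝ
  have hTM : (normSeminorm ℝ ℂ).comp (T : ℂ →ₗ[ℝ] ℂ) =
      (normSeminorm ℝ ℂ).comp (M : ℂ →ₗ[ℝ] ℂ) := by
    ext z
    change ‖‖x‖ • z‖ = ‖x • z‖
    simp
  have h1 := planarForm_comp (normSeminorm ℝ ℂ) T 1
  rw [hTM, planarForm_comp] at h1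
  have h2 : T 1 = ‖x‖ • 1 := rfl
  have h3 : M 1 = x := by
    change x • (1 : ℂ) = x
    simp
  rw [h2, h3, planarForm_smul] at h1
  rw [h1, mul_comm]

/-- A planar norm is normalised if the associated quadratic form is the standard one. -/
structure IsNormalised (N : Seminorm ℝ ℂ) : Prop where
  continuous : Continuous N
  definite : ∀ x, N x = 0 → x = 0
  form_eq : ∀ x, planarForm N x = ‖x‖ ^ 2

/-- Normalised planar norms are uniformly equivalent to the Euclidean norm. -/
lemma exists_normalised_bounds : ∃ a b : ℝ, 0 < a ∧ 0 < b ∧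
    ∀ N : Seminorm ℝ ℂ, IsNormalised N → ∀ z, a * ‖z‖ ≤ N z ∧ N z ≤ b * ‖z‖ := by
  obtain ⟨κ, hκ, hform⟩ := exists_planarForm_norm
  set E := normSeminorm ℝ ℂ with hE
  have hEc : Continuous E := continuous_norm
  have hE0 : ∀ x, E x = 0 → x = 0 := fun x hx => norm_eq_zero.1 hx
  set q : ℂ ≃ₗ[ℝ] ℂ := LinearEquiv.smulOfNeZero ℝ ℂ (1 / 4 : ℝ) (by norm_num) with hq
  have hqz : ∀ z, q z = (1 / 4 : ℝ) • z := fun z => rfl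
  set E' := E.comp (q : ℂ →ₗ[ℝ] ℂ) with hE'
  have hE'z : ∀ z, E' z = (1 / 4) * ‖z‖ := fun z => by
    change ‖(1 / 4 : ℝ) • z‖ = _
    rw [norm_smul]
    norm_num
  have hE'c : Continuous E' := continuous_seminorm_comp hEc _
  have hE'0 : ∀ x, E' x = 0 → x = 0 := definite_seminorm_comp hE0 q.injective
  set k := Real.sqrt (κ / 16) with hk
  have hkpos : 0 < k := Real.sqrt_pos.2 (by positivity)
  have hk2 : k ^ 2 = κ / 16 := Real.sq_sqrt (by positivity)
  have hE'f : ∀ x, planarForm E' x = k ^ 2 * ‖x‖ ^ 2 := fun x => by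
    rw [hE', planarForm_comp, hqz, planarForm_smul, hform, hk2]
    ring
  refine ⟨1 / (4 * (64 * k)), 16 / k, by positivity, by positivity, fun N hN z => ?_⟩
  obtain ⟨T, hT1, hT2⟩ := exists_john_position hN.continuous hN.definite
  set T' : ℂ ≃ₗ[ℝ] ℂ := T.toLinearEquiv with hT'
  have hlow : ∀ x, ‖x‖ ≤ 4 * N (T x) := by
    intro x
    rcases eq_or_ne x 0 with rfl | hx
    · simp
    have hx' : 0 < ‖x‖ := norm_pos_iff.2 hx
    have h := john_position_lower_bound (p := N.comp (T' : ℂ →ₗ[ℝ] ℂ)) (x := ‖x‖⁻¹ • x)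
      (fun x => hT1 x) (by simp [hx'.ne']) (by
        intro s hs
        exact hT2 _ (by simp [hx'.ne']) s hs)
    rw [Complex.finrank_real_complex, map_smul_eq_mul, norm_inv, norm_norm] at h
    have h' : N.comp (T' : ℂ →ₗ[ℝ] ℂ) x = N (T x) := rfl
    rw [h'] at h
    calc ‖x‖ = ‖x‖ * 1 := (mul_one _).symm
      _ ≤ ‖x‖ * (2 * (2 : ℕ) * (‖x‖⁻¹ * N (T x))) := by gcongr
      _ = 4 * N (T x) := by
        field_simp
        ring
  have hst := planarForm_stable hE'c hE'0
    (continuous_seminorm_comp hN.continuous (T' : ℂ →ₗ[ℝ] ℂ)) (r := 4) (by norm_num)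
    (fun z => by
      rw [hE'z]
      change _ ≤ N (T z)
      linarith [hlow z])
    (fun z => by
      rw [hE'z]
      change N (T z) ≤ _
      linarith [hT1 z])
  obtain ⟨x, rfl⟩ := T.surjective z
  obtain ⟨h1, h2⟩ := hst x
  rw [hE'f, planarForm_comp] at h1 h2
  have hTx : T' x = T x := rfl
  rw [hTx, hN.form_eq] at h1 h2
  have g1 : k * ‖x‖ ≤ 16 * ‖T x‖ := by
    refine le_of_sq_le_sq ?_ (by positivity)
    nlinarith
  have g2 : ‖T x‖ ≤ 64 * k * ‖x‖ := by
    refine le_of_sq_le_sq ?_ (by positivity)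
    nlinarith
  constructor
  · calc 1 / (4 * (64 * k)) * ‖T x‖ ≤ 1 / (4 * (64 * k)) * (64 * k * ‖x‖) := by gcongr
      _ = ‖x‖ / 4 := by field_simp
      _ ≤ _ := by linarith [hlow x]
  · calc N (T x) ≤ ‖x‖ := hT1 x
      _ = (k * ‖x‖) / k := by field_simp
      _ ≤ (16 * ‖T x‖) / k := by gcongr
      _ = _ := by ring

/-- The (unnormalised) Fourier coefficients of the restriction of `f` to the unit circle. -/
noncomputable def fourierInt (f : ℂ → ℝ) (k : ℤ) : ℂ :=
  ∫ t in (0 : ℝ)..2 * Real.pi, Complex.exp (k * t * Complex.I) * (f (Complex.exp (t * Complex.I)) : ℂ)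

lemma periodic_fourier_integrand (f : ℂ → ℝ) (k : ℤ) : Function.Periodic (fun t : ℝ =>
    Complex.exp (k * t * Complex.I) * (f (Complex.exp (t * Complex.I)) : ℂ)) (2 * Real.pi) := by
  intro t
  have h1 : Complex.exp (((t + 2 * Real.pi : ℝ) : ℂ) * Complex.I) =
      Complex.exp (t * Complex.I) := by
    push_cast
    rw [add_mul, Complex.exp_add, Complex.exp_two_pi_mul_I, mul_one]
  have h2 : Complex.exp (k * ((t + 2 * Real.pi : ℝ) : ℂ) * Complex.I) =
      Complex.exp (k * t * Complex.I) := by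
    rw [show (k : ℂ) * ((t + 2 * Real.pi : ℝ) : ℂ) * Complex.I =
      k * t * Complex.I + k * (2 * Real.pi * Complex.I) by push_cast; ring, Complex.exp_add,
      Complex.exp_int_mul_two_pi_mul_I, mul_one]
  simp only [h1, h2]

lemma fourierInt_rotate (f : ℂ → ℝ) (k : ℤ) (θ : ℝ) :
    fourierInt (fun z => f (Complex.exp (θ * Complex.I) * z)) k =
      Complex.exp (-(k * θ * Complex.I)) * fourierInt f k := by
  have h : ∀ t : ℝ, Complex.exp (k * t * Complex.I) *
      (f (Complex.exp (θ * Complex.I) * Complex.exp (t * Complex.I)) : ℂ) =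
      Complex.exp (-(k * θ * Complex.I)) * (Complex.exp (k * (t + θ : ℝ) * Complex.I) *
        (f (Complex.exp ((t + θ : ℝ) * Complex.I)) : ℂ)) := fun t => by
    rw [← Complex.exp_add, ← mul_assoc, ← Complex.exp_add]
    congr 2
    · push_cast
      ring
    · congr 3
      push_cast
      ring
  simp only [fourierInt, h]
  rw [intervalIntegral.integral_const_mul, intervalIntegral.integral_comp_add_right
    (fun t : ℝ => Complex.exp (k * t * Complex.I) * (f (Complex.exp (t * Complex.I)) : ℂ)),
    zero_add, add_comm (2 * Real.pi) θ,
    (periodic_fourier_integrand f k).intervalIntegral_add_eq θ 0, zero_add]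

lemma fourierInt_neg (f : ℂ → ℝ) (k : ℤ) :
    fourierInt f (-k) = (starRingEnd ℂ) (fourierInt f k) := by
  rw [fourierInt, fourierInt, intervalIntegral.integral_of_le (by positivity),
    intervalIntegral.integral_of_le (by positivity), ← integral_conj]
  congr 1
  funext t
  rw [map_mul, Complex.conj_ofReal, ← Complex.exp_conj]
  congr 2
  simp

lemma fourierInt_conj (f : ℂ → ℝ) (k : ℤ) :
    fourierInt (fun z => f ((starRingEnd ℂ) z)) k = (starRingEnd ℂ) (fourierInt f k) := by
  have h : ∀ t : ℝ, Complex.exp (k * t * Complex.I) *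
      (f ((starRingEnd ℂ) (Complex.exp (t * Complex.I))) : ℂ) =
      Complex.exp ((-k : ℤ) * (-t : ℝ) * Complex.I) *
        (f (Complex.exp ((-t : ℝ) * Complex.I)) : ℂ) := fun t => by
    rw [← Complex.exp_conj]
    congr 2
    · push_cast
      ring
    · congr 2
      simp
  rw [← fourierInt_neg]
  simp only [fourierInt, h]
  rw [intervalIntegral.integral_comp_neg (fun t : ℝ => Complex.exp ((-k : ℤ) * t * Complex.I) *
    (f (Complex.exp (t * Complex.I)) : ℂ))]
  have := (periodic_fourier_integrand f (-k)).intervalIntegral_add_eq (-(2 * Real.pi)) 0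
  simpa using this

/-- A linear map of the plane that almost preserves the Euclidean norm is close to a rotation or
to a reflection. -/
lemma exists_isometry_near (T : ℂ →ₗ[ℝ] ℂ) {η : ℝ} (hη : η ≤ 63)
    (hlow : ∀ z, ‖z‖ ^ 2 ≤ 16 * ‖T z‖ ^ 2)
    (h : ∀ z, |‖T z‖ ^ 2 - ‖z‖ ^ 2| ≤ η * ‖z‖ ^ 2) :
    ∃ θ : ℝ, (∀ z, ‖T z - Complex.exp (θ * Complex.I) * z‖ ≤ 4100 * η * ‖z‖) ∨
      ∀ z, ‖T z - Complex.exp (θ * Complex.I) * (starRingEnd ℂ) z‖ ≤ 4100 * η * ‖z‖ := by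
  set ω := Complex.exp (((T 1).arg : ℝ) * Complex.I) with hω
  have hω1 : ‖ω‖ = 1 := Complex.norm_exp_ofReal_mul_I _
  set w := (starRingEnd ℂ) ω * T Complex.I with hw
  have hωω : ω * (starRingEnd ℂ) ω = 1 := by
    rw [Complex.mul_conj', hω1]
    simp
  set p := ‖T 1‖ with hp
  have hP : T 1 = ω * p := by
    rw [mul_comm]
    exact (Complex.norm_mul_exp_arg_mul_I (T 1)).symm
  have hQ : T Complex.I = ω * w := by rw [hw, ← mul_assoc, hωω, one_mul]
  have hT : ∀ z : ℂ, T z = ω * (z.re * p + z.im * w) := fun z => by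
    have : T z = z.re • T 1 + z.im • T Complex.I := by
      rw [← map_smul, ← map_smul, ← map_add]
      congr 1
      apply Complex.ext <;> simp
    rw [this, hP, hQ, Complex.real_smul, Complex.real_smul]
    ring
  have hTn : ∀ z : ℂ, ‖T z‖ ^ 2 = (z.re * p + z.im * w.re) ^ 2 + (z.im * w.im) ^ 2 := fun z => by
    rw [hT, norm_mul, hω1, one_mul, ← Complex.normSq_eq_norm_sq, Complex.normSq_apply]
    simp
    ring
  have e1 := h 1
  have e2 := h Complex.I
  have e3 := h (1 + Complex.I)
  have e4 := hlow 1
  have e5 : ‖(1 + Complex.I : ℂ)‖ ^ 2 = 2 := by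
    rw [← Complex.normSq_eq_norm_sq, Complex.normSq_apply]
    simp
    norm_num
  rw [e5] at e3
  rw [hTn] at e1 e2 e3 e4
  simp only [Complex.one_re, one_mul, Complex.one_im, zero_mul, add_zero, norm_one, one_pow,
    mul_one, Complex.I_re, Complex.I_im, zero_add, Complex.norm_I, Complex.add_re,
    Complex.add_im, ne_eq, OfNat.ofNat_ne_zero, not_false_eq_true, zero_pow] at e1 e2 e3 e4
  have hp0 : 0 ≤ p := norm_nonneg _
  have hp4 : 1 / 4 ≤ p := by nlinarith
  have hη0 : 0 ≤ η := (abs_nonneg _).trans e1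
  rw [abs_le] at e1 e2 e3
  have k1 : |p - 1| ≤ η := by
    rw [abs_le]
    constructor <;> nlinarith
  have k2 : |w.re| ≤ 8 * η := by
    have h8 : |p * w.re| ≤ 2 * η := by
      rw [abs_le]
      constructor <;> nlinarith
    rw [abs_mul, abs_of_nonneg hp0] at h8
    nlinarith [abs_nonneg w.re]
  have k3 : w.re ^ 2 ≤ 64 * 63 * η := by
    rw [← sq_abs]
    nlinarith [abs_nonneg w.re]
  have k4 : |(|w.im| - 1)| ≤ 4033 * η := by
    have h0 := abs_nonneg w.im
    have h9 : |w.im| ^ 2 = w.im ^ 2 := sq_abs _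
    have hx := sq_nonneg w.re
    have h10 : |(|w.im| - 1)| * (|w.im| + 1) ≤ 4033 * η := by
      rw [← abs_of_nonneg (add_nonneg h0 zero_le_one), ← abs_mul, abs_le]
      constructor <;> linarith [e2.1, e2.2]
    exact (le_mul_of_one_le_right (abs_nonneg _) (by linarith)).trans h10
  have key : ∀ (ε : ℝ), ε * |w.im| = w.im → |ε| = 1 → ∀ z : ℂ,
      ‖T z - ω * (z.re + z.im * (ε * Complex.I))‖ ≤ 4100 * η * ‖z‖ := by
    intro ε hε hε1 z
    have : T z - ω * (z.re + z.im * (ε * Complex.I)) =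
        ω * ((z.re * (p - 1) : ℝ) + (z.im : ℝ) * ((w.re : ℝ) + (w.im - ε : ℝ) * Complex.I)) := by
      rw [hT]
      conv_lhs => rw [← Complex.re_add_im w]
      push_cast
      ring
    rw [this, norm_mul, hω1, one_mul]
    have hwε : |w.im - ε| ≤ 4033 * η := by
      have : w.im - ε = ε * (|w.im| - 1) := by rw [mul_sub, hε, mul_one]
      rw [this, abs_mul, hε1, one_mul]
      exact k4
    calc _ ≤ ‖((z.re * (p - 1) : ℝ) : ℂ)‖ +
          ‖(z.im : ℂ) * ((w.re : ℝ) + (w.im - ε : ℝ) * Complex.I)‖ := norm_add_le _ _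
      _ ≤ |z.re| * |p - 1| + |z.im| * (|w.re| + |w.im - ε|) := by
          rw [norm_mul, Complex.norm_real, Complex.norm_real, Real.norm_eq_abs, Real.norm_eq_abs,
            abs_mul]
          gcongr
          refine (norm_add_le _ _).trans ?_
          rw [norm_mul, Complex.norm_I, mul_one, Complex.norm_real, Complex.norm_real,
            Real.norm_eq_abs, Real.norm_eq_abs]
      _ ≤ ‖z‖ * η + ‖z‖ * (8 * η + 4033 * η) := by
          gcongr
          · exact Complex.abs_re_le_norm z
          · exact Complex.abs_im_le_norm z
      _ ≤ 4100 * η * ‖z‖ := by nlinarith [norm_nonneg z, mul_nonneg hη0 (norm_nonneg z)]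
  refine ⟨(T 1).arg, ?_⟩
  rcases le_total 0 w.im with hs | hs
  · left
    intro z
    have := key 1 (by rw [abs_of_nonneg hs, one_mul]) (by simp) z
    rw [Complex.ofReal_one, one_mul, Complex.re_add_im] at this
    exact this
  · right
    intro z
    have := key (-1) (by rw [abs_of_nonpos hs]; ring) (by simp) z
    have hz : (z.re + z.im * (((-1 : ℝ) : ℂ) * Complex.I)) = (starRingEnd ℂ) z := by
      apply Complex.ext <;> simp
    rw [hz] at this
    exact this

lemma norm_fourierInt_sub_le {f g : ℂ → ℝ} (hf : Continuous f) (hg : Continuous g) {r : ℝ}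
    (h : ∀ z, ‖z‖ = 1 → |f z - g z| ≤ r) (k : ℤ) :
    ‖fourierInt f k - fourierInt g k‖ ≤ r * (2 * Real.pi) := by
  rw [fourierInt, fourierInt, ← intervalIntegral.integral_sub
    (Continuous.intervalIntegrable (by fun_prop) _ _)
    (Continuous.intervalIntegrable (by fun_prop) _ _)]
  have := intervalIntegral.norm_integral_le_of_norm_le_const (a := 0) (b := 2 * Real.pi) (C := r)
    (f := fun t : ℝ => Complex.exp (k * t * Complex.I) * (f (Complex.exp (t * Complex.I)) : ℂ) -
      Complex.exp (k * t * Complex.I) * (g (Complex.exp (t * Complex.I)) : ℂ)) fun t _ => ?_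
  · rwa [sub_zero, abs_of_nonneg (by positivity)] at this
  · rw [← mul_sub, norm_mul, ← Complex.ofReal_sub, Complex.norm_real, Real.norm_eq_abs,
      show (k : ℂ) * t * Complex.I = ((k * t : ℝ) : ℂ) * Complex.I by push_cast; rfl,
      Complex.norm_exp_ofReal_mul_I, one_mul]
    exact h _ (Complex.norm_exp_ofReal_mul_I t)

/-- If a normalised planar norm is `δ`-close, up to a linear map, to one with vanishing `k`-th
Fourier coefficient, then its own `k`-th coefficient is `O(δ)`. -/
lemma exists_fourierInt_bound : ∃ C : ℝ, 0 < C ∧ ∀ N N' : Seminorm ℝ ℂ, IsNormalised N →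
    IsNormalised N' → ∀ (T : ℂ ≃ₗ[ℝ] ℂ) (δ : ℝ), 0 < δ → δ ≤ 1 → (∀ z, N' z ≤ N (T z)) →
    (∀ z, N (T z) ≤ (1 + δ) * N' z) → ∀ k : ℤ, fourierInt N k = 0 → ‖fourierInt N' k‖ ≤ C * δ := by
  obtain ⟨a, b, ha, hb, hab⟩ := exists_normalised_bounds
  refine ⟨(b + b * (4100 * 63)) * (2 * Real.pi), by positivity,
    fun N N' hN hN' T δ hδ hδ1 h1 h2 k hk => ?_⟩
  have hc := continuous_seminorm_comp hN.continuous (T : ℂ →ₗ[ℝ] ℂ)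
  have hst := planarForm_stable hN'.continuous hN'.definite hc (r := 1 + δ) (by positivity)
    (fun z => h1 z) (fun z => h2 z)
  simp only [planarForm_comp, hN.form_eq, hN'.form_eq] at hst
  have hp6 : (1 + δ) ^ 6 ≤ 1 + 63 * δ := by
    have h2 : δ ^ 2 ≤ δ := by nlinarith
    have h3 : δ ^ 3 ≤ δ := by nlinarith
    have h4 : δ ^ 4 ≤ δ := by nlinarith
    have h5 : δ ^ 5 ≤ δ := by nlinarith
    have h6 : δ ^ 6 ≤ δ := by nlinarith
    nlinarith
  have hp4 : (1 + δ) ^ 4 ≤ 1 + 15 * δ := by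
    have h2 : δ ^ 2 ≤ δ := by nlinarith
    have h3 : δ ^ 3 ≤ δ := by nlinarith
    have h4 : δ ^ 4 ≤ δ := by nlinarith
    nlinarith
  obtain ⟨θ, hθ⟩ := exists_isometry_near (T : ℂ →ₗ[ℝ] ℂ) (η := 63 * δ) (by linarith)
    (fun z => (hst z).1.trans (by
      have := sq_nonneg ‖T z‖
      rw [LinearEquiv.coe_coe]
      nlinarith))
    (fun z => by
      obtain ⟨g1, g2⟩ := hst z
      rw [LinearEquiv.coe_coe]
      have p1 := sq_nonneg ‖T z‖
      have p2 := sq_nonneg ‖z‖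
      have g3 : ‖z‖ ^ 2 ≤ (1 + 15 * δ) * ‖T z‖ ^ 2 := g1.trans (by gcongr)
      have g4 : ‖T z‖ ^ 2 ≤ (1 + 63 * δ) * ‖z‖ ^ 2 := g2.trans (by gcongr)
      rw [abs_le]
      constructor
      · by_cases hlt : ‖T z‖ ^ 2 ≤ ‖z‖ ^ 2
        · nlinarith
        · nlinarith
      · nlinarith)
  have hclose : ∀ z v : ℂ, ‖z‖ = 1 → ‖T z - v‖ ≤ 4100 * (63 * δ) * ‖z‖ →
      |N' z - N v| ≤ (b + b * (4100 * 63)) * δ := by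
    intro z v hz hv
    rw [hz, mul_one] at hv
    have t1 : |N (T z) - N v| ≤ N (T z - v) := abs_sub_map_le_sub N _ _
    have t2 := (hab N hN (T z - v)).2
    have t3 := (hab N' hN' z).2
    have t4 := h1 z
    have t5 := h2 z
    rw [hz, mul_one] at t3
    have t6 : b * ‖T z - v‖ ≤ b * (4100 * (63 * δ)) := by gcongr
    have t7 : δ * N' z ≤ δ * b := by gcongr
    rw [abs_le] at t1 ⊢
    constructor <;> nlinarith [t1.1, t1.2]
  rcases hθ with hθ | hθ
  · have hz : fourierInt (fun z => N (Complex.exp (θ * Complex.I) * z)) k = 0 := by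
      rw [fourierInt_rotate, hk, mul_zero]
    have := norm_fourierInt_sub_le hN'.continuous
      (g := fun z => N (Complex.exp (θ * Complex.I) * z))
      (hN.continuous.comp (by fun_prop)) (fun z hz => hclose z _ hz (hθ z)) k
    rw [hz, sub_zero] at this
    linarith
  · have hz : fourierInt (fun z => N (Complex.exp (θ * Complex.I) * (starRingEnd ℂ) z)) k = 0 := by
      rw [fourierInt_conj (fun z => N (Complex.exp (θ * Complex.I) * z)), fourierInt_rotate, hk,
        mul_zero, map_zero]
    have := norm_fourierInt_sub_le hN'.continuous
      (g := fun z => N (Complex.exp (θ * Complex.I) * (starRingEnd ℂ) z))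
      (hN.continuous.comp (by fun_prop))
      (fun z hz => hclose z _ hz (hθ z)) k
    rw [hz, sub_zero] at this
    linarith

/-- The real-linear map from the complex plane sending `1` to `u` and `I` to `v`. -/
noncomputable def frameMap {V : Type*} [AddCommGroup V] [Module ℝ V] (u v : V) : ℂ →ₗ[ℝ] V :=
  Complex.reLm.smulRight u + Complex.imLm.smulRight v

lemma frameMap_apply {V : Type*} [AddCommGroup V] [Module ℝ V] (u v : V) (z : ℂ) :
    frameMap u v z = z.re • u + z.im • v := rfl

lemma continuous_integral_tent {X V : Type*} [TopologicalSpace X] [FirstCountableTopology X]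
    [LocallyCompactSpace X] [NormedAddCommGroup V] [NormedSpace ℝ V] {p : Seminorm ℝ V}
    (hp : Continuous p) {u v : X → V} (hu : Continuous u) (hv : Continuous v) {m : ℝ} (hm : 0 < m)
    (hmp : ∀ x z, m * ‖z‖ ≤ p (frameMap (u x) (v x) z)) {h : ℂ → ℝ} (hh : Continuous h) :
    Continuous fun x => ∫ y, h y * max (1 - p.comp (frameMap (u x) (v x)) y) 0 := by
  have : ∀ x, ∫ y, h y * max (1 - p.comp (frameMap (u x) (v x)) y) 0 =
      ∫ y in closedBall (0 : ℂ) m⁻¹, h y * max (1 - p.comp (frameMap (u x) (v x)) y) 0 := by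
    intro x
    refine (MeasureTheory.setIntegral_eq_integral_of_forall_compl_eq_zero fun y hy => ?_).symm
    rw [max_one_sub_eq_zero hm (fun z => hmp x z) hy, mul_zero]
  simp_rw [this]
  refine continuous_parametric_integral_of_continuous ?_ (isCompact_closedBall _ _)
  simp only [Function.uncurry_def, Seminorm.comp_apply, frameMap_apply]
  fun_prop

/-- The entries of the (triangular) matrix that normalises a planar norm. -/
noncomputable def normAlpha (N : Seminorm ℝ ℂ) : ℝ := (Real.sqrt (planarForm N 1))⁻¹

noncomputable def normGamma (N : Seminorm ℝ ℂ) : ℝ :=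
  Real.sqrt (planarForm N 1 /
    (planarForm N 1 * planarForm N Complex.I - planarCross N ^ 2))

noncomputable def normBeta (N : Seminorm ℝ ℂ) : ℝ :=
  -(planarCross N / planarForm N 1) * normGamma N

lemma planarForm_discr_pos {N : Seminorm ℝ ℂ} (hN : Continuous N) (hN0 : ∀ x, N x = 0 → x = 0) :
    0 < planarForm N 1 * planarForm N Complex.I - planarCross N ^ 2 := by
  have h1 := planarForm_pos hN hN0 one_ne_zero
  have h2 := planarForm_pos hN hN0 (x := ⟨-planarCross N, planarForm N 1⟩) fun h =>
    h1.ne' (congrArg Complex.im h)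
  rw [planarForm_apply hN hN0] at h2
  simp only at h2
  have h3 : 0 < planarForm N 1 *
      (planarForm N 1 * planarForm N Complex.I - planarCross N ^ 2) := by
    linarith
  exact pos_of_mul_pos_right h3 h1.le

/-- Every planar norm becomes normalised after an explicit triangular change of variables. -/
lemma isNormalised_comp_frameMap {N : Seminorm ℝ ℂ} (hN : Continuous N)
    (hN0 : ∀ x, N x = 0 → x = 0) :
    Function.Injective (frameMap (normAlpha N : ℂ) (normBeta N + normGamma N * Complex.I)) ∧
    IsNormalised (N.comp (frameMap (normAlpha N : ℂ) (normBeta N + normGamma N * Complex.I))) := by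
  set G := frameMap (normAlpha N : ℂ) (normBeta N + normGamma N * Complex.I) with hG
  have h1 := planarForm_pos hN hN0 one_ne_zero
  have hΔ := planarForm_discr_pos hN hN0
  have hα : planarForm N 1 * normAlpha N ^ 2 = 1 := by
    rw [normAlpha, inv_pow, Real.sq_sqrt h1.le, mul_inv_cancel₀ h1.ne']
  have hγ : normGamma N ^ 2 * (planarForm N 1 * planarForm N Complex.I - planarCross N ^ 2) =
      planarForm N 1 := by
    rw [normGamma, Real.sq_sqrt (by positivity), div_mul_cancel₀ _ hΔ.ne']
  have hβ : planarForm N 1 * normBeta N = -planarCross N * normGamma N := by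
    rw [normBeta]
    field_simp
  have hform : ∀ z, planarForm N (G z) = ‖z‖ ^ 2 := by
    intro z
    have hre : (G z).re = z.re * normAlpha N + z.im * normBeta N := by
      rw [hG, frameMap_apply]
      simp
    have him : (G z).im = z.im * normGamma N := by
      rw [hG, frameMap_apply]
      simp
    rw [planarForm_apply hN hN0, hre, him, ← Complex.normSq_eq_norm_sq, Complex.normSq_apply]
    refine mul_left_cancel₀ h1.ne' ?_
    linear_combination (planarForm N 1 * z.re ^ 2) * hα + z.im ^ 2 * hγ +
      (2 * planarForm N 1 * z.re * z.im * normAlpha N +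
        z.im ^ 2 * (planarForm N 1 * normBeta N + planarCross N * normGamma N)) * hβ
  have hinj : Function.Injective G := by
    rw [← LinearMap.ker_eq_bot, LinearMap.ker_eq_bot']
    intro z hz
    have h2 := hform z
    have h3 := planarForm_smul N 0 0
    rw [zero_smul, zero_pow two_ne_zero, zero_mul] at h3
    rw [hz, h3] at h2
    simpa using h2.symm
  refine ⟨hinj, continuous_seminorm_comp hN G, definite_seminorm_comp hN0 hinj, fun x => ?_⟩
  have h := planarForm_comp N (LinearEquiv.ofInjectiveEndo G hinj) x
  have hco : ((LinearEquiv.ofInjectiveEndo G hinj : ℂ ≃ₗ[ℝ] ℂ) : ℂ →ₗ[ℝ] ℂ) = G := by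
    ext
    rfl
  rw [hco] at h
  rw [h]
  exact hform x

lemma frameMap_comp_frameMap {V : Type*} [AddCommGroup V] [Module ℝ V] (u v : V) (α β γ : ℝ) :
    (frameMap u v).comp (frameMap (α : ℂ) (β + γ * Complex.I)) =
      frameMap (α • u) (β • u + γ • v) := by
  refine LinearMap.ext fun z => ?_
  simp only [LinearMap.comp_apply, frameMap_apply]
  simp only [Complex.real_smul, Complex.add_re, Complex.mul_re, Complex.ofReal_re,
    Complex.ofReal_im, Complex.add_im, Complex.mul_im, Complex.I_re, Complex.I_im]
  module

lemma IsNormalised.coeffs {N : Seminorm ℝ ℂ} (hN : IsNormalised N) :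
    normAlpha N = 1 ∧ normBeta N = 0 ∧ normGamma N = 1 := by
  have h1 : planarForm N 1 = 1 := by simp [hN.form_eq]
  have h2 : planarForm N Complex.I = 1 := by simp [hN.form_eq]
  have h3 : planarCross N = 0 := by
    have h := planarForm_apply hN.continuous hN.definite (1 + Complex.I)
    rw [hN.form_eq, h1, h2, ← Complex.normSq_eq_norm_sq, Complex.normSq_apply] at h
    simp at h
    linarith
  simp [normAlpha, normBeta, normGamma, h1, h2, h3]

lemma exists_pos_mul_sqrt_le {V : Type*} [NormedAddCommGroup V] [NormedSpace ℝ V]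
    {p : Seminorm ℝ V} (hp : Continuous p)
    (hp0 : ∀ x, p x = 0 → x = 0) {a b c : V} (hli : LinearIndependent ℝ ![a, b, c]) :
    ∃ m : ℝ, 0 < m ∧ ∀ x y z : ℝ,
      m * Real.sqrt (x ^ 2 + y ^ 2 + z ^ 2) ≤ p (x • a + y • b + z • c) := by
  set ψ : EuclideanSpace ℝ (Fin 3) →ₗ[ℝ] V :=
    (Fintype.linearCombination ℝ ![a, b, c]).comp
      (WithLp.linearEquiv 2 ℝ (Fin 3 → ℝ)).toLinearMap with hψ
  have hinj : Function.Injective ψ :=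
    hli.fintypeLinearCombination_injective.comp (WithLp.linearEquiv 2 ℝ (Fin 3 → ℝ)).injective
  obtain ⟨m, hm, h⟩ := exists_pos_mul_norm_le (continuous_seminorm_comp hp ψ)
    (definite_seminorm_comp hp0 hinj)
  refine ⟨m, hm, fun x y z => ?_⟩
  have := h !₂[x, y, z]
  rw [EuclideanSpace.norm_eq, Fin.sum_univ_three, Seminorm.comp_apply, hψ, LinearMap.comp_apply,
    Fintype.linearCombination_apply, Fin.sum_univ_three] at this
  simpa using this

/-- In a three-dimensional space, any given Fourier mode vanishes for some normalised
plane section. -/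
lemma exists_fourierInt_eq_zero {V : Type*} [NormedAddCommGroup V] [NormedSpace ℝ V]
    {p : Seminorm ℝ V} (hp : Continuous p)
    (hp0 : ∀ x, p x = 0 → x = 0) {a b c : V} (hli : LinearIndependent ℝ ![a, b, c])
    (hN : IsNormalised (p.comp (frameMap a b))) {k : ℤ} (hk : k ≠ 0) :
    ∃ ι : ℂ →ₗ[ℝ] V, Function.Injective ι ∧ IsNormalised (p.comp ι) ∧
      fourierInt (p.comp ι) k = 0 := by
  obtain ⟨m, hm, hmp⟩ := exists_pos_mul_sqrt_le hp hp0 hli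
  set u : ℝ × ℝ → V := fun x => Real.cos x.2 • a + (Real.cos x.1 * Real.sin x.2) • b +
    (-(Real.sin x.1 * Real.sin x.2)) • c with hu
  set v : ℝ × ℝ → V := fun x => (-(Real.cos x.1 * Real.sin x.2)) • a +
    (Real.cos x.1 ^ 2 * Real.cos x.2 + Real.sin x.1 ^ 2) • b +
    (Real.sin x.1 * Real.cos x.1 * (1 - Real.cos x.2)) • c with hv
  have huc : Continuous u := by fun_prop
  have hvc : Continuous v := by fun_prop
  have hlow : ∀ x z, m * ‖z‖ ≤ p (frameMap (u x) (v x) z) := by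
    intro x z
    have h := hmp (z.re * Real.cos x.2 - z.im * (Real.cos x.1 * Real.sin x.2))
      (z.re * (Real.cos x.1 * Real.sin x.2) +
        z.im * (Real.cos x.1 ^ 2 * Real.cos x.2 + Real.sin x.1 ^ 2))
      (-(z.re * (Real.sin x.1 * Real.sin x.2)) +
        z.im * (Real.sin x.1 * Real.cos x.1 * (1 - Real.cos x.2)))
    have h1 := Real.cos_sq_add_sin_sq x.1
    have h2 := Real.cos_sq_add_sin_sq x.2
    convert h using 2
    · rw [Complex.norm_eq_sqrt_sq_add_sq]
      congr 1
      generalize Real.cos x.1 = c1 at *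
      generalize Real.sin x.1 = s1 at *
      generalize Real.cos x.2 = c2 at *
      generalize Real.sin x.2 = s2 at *
      linear_combination -(z.re ^ 2 * (s2 ^ 2 * h1 + h2)) -
        z.im ^ 2 * ((c1 ^ 2 * c2 ^ 2 + s1 ^ 2) * h1 + c1 ^ 2 * h2 + h1) -
        2 * z.re * z.im * (c1 * s2 * c2 * h1)
    · rw [frameMap_apply, hu, hv]
      module
  set F : ℝ × ℝ → Seminorm ℝ ℂ := fun x => p.comp (frameMap (u x) (v x)) with hF
  have hFinj : ∀ x, Function.Injective (frameMap (u x) (v x)) := by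
    intro x
    rw [← LinearMap.ker_eq_bot, LinearMap.ker_eq_bot']
    intro z hz
    have := hlow x z
    rw [hz, map_zero] at this
    exact norm_le_zero_iff.1 (by nlinarith [norm_nonneg z])
  have hFc : ∀ x, Continuous (F x) := fun x => continuous_seminorm_comp hp _
  have hF0 : ∀ x y, F x y = 0 → y = 0 := fun x => definite_seminorm_comp hp0 (hFinj x)
  have hA : Continuous fun x => planarMass (F x) := by
    simpa [planarMass, hF] using continuous_integral_tent hp huc hvc hm hlow
      (h := fun _ => 1) continuous_const
  have hApos : ∀ x, planarMass (F x) ^ 3 ≠ 0 := fun x =>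
    pow_ne_zero 3 (planarMass_pos (hFc x) (hF0 x)).ne'
  have hQ : ∀ w, Continuous fun x => planarForm (F x) w := fun w =>
    (continuous_integral_tent hp huc hvc hm hlow (by fun_prop)).div (hA.pow 3) hApos
  have hX : Continuous fun x => planarCross (F x) :=
    (continuous_integral_tent hp huc hvc hm hlow (h := fun y => y.re * y.im)
      (by fun_prop)).neg.div (hA.pow 3) hApos
  have hQ1 : ∀ x, planarForm (F x) 1 ≠ 0 := fun x =>
    (planarForm_pos (hFc x) (hF0 x) one_ne_zero).ne'
  have hα : Continuous fun x => normAlpha (F x) :=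
    (Real.continuous_sqrt.comp (hQ 1)).inv₀ fun x =>
      (Real.sqrt_pos.2 (planarForm_pos (hFc x) (hF0 x) one_ne_zero)).ne'
  have hγ : Continuous fun x => normGamma (F x) :=
    Real.continuous_sqrt.comp ((hQ 1).div (((hQ 1).mul (hQ _)).sub (hX.pow 2)) fun x =>
      (planarForm_discr_pos (hFc x) (hF0 x)).ne')
  have hβ : Continuous fun x => normBeta (F x) := ((hX.div (hQ 1) hQ1).neg).mul hγ
  set u' : ℝ × ℝ → V := fun x => normAlpha (F x) • u x with hu'
  set v' : ℝ × ℝ → V := fun x => normBeta (F x) • u x + normGamma (F x) • v x with hv'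
  have hu'c : Continuous u' := hα.smul huc
  have hv'c : Continuous v' := (hβ.smul huc).add (hγ.smul hvc)
  have hcomp : ∀ x, frameMap (u' x) (v' x) = (frameMap (u x) (v x)).comp
      (frameMap (normAlpha (F x) : ℂ) (normBeta (F x) + normGamma (F x) * Complex.I)) := fun x =>
    (frameMap_comp_frameMap _ _ _ _ _).symm
  have hnorm : ∀ x, Function.Injective (frameMap (u' x) (v' x)) ∧
      IsNormalised (p.comp (frameMap (u' x) (v' x))) := by
    intro x
    obtain ⟨h1, h2⟩ := isNormalised_comp_frameMap (hFc x) (hF0 x)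
    rw [hcomp]
    exact ⟨(hFinj x).comp h1, h2⟩
  have hrot : ∀ (x : ℝ × ℝ) (φ : ℝ), (∀ z, frameMap (u x) (v x) z =
      frameMap a b (Complex.exp (φ * Complex.I) * z)) →
      fourierInt (p.comp (frameMap (u' x) (v' x))) k =
        Complex.exp (-(k * φ * Complex.I)) * fourierInt (p.comp (frameMap a b)) k := by
    intro x φ h
    have hFx : IsNormalised (F x) := by
      refine ⟨hFc x, hF0 x, fun y => ?_⟩
      set M : ℂ ≃ₗ[ℝ] ℂ := (LinearEquiv.smulOfNeZero ℂ ℂ (Complex.exp (φ * Complex.I))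
        (Complex.exp_ne_zero _)).restrictScalars ℝ
      have hM : ∀ z, M z = Complex.exp (φ * Complex.I) * z := fun z => rfl
      have : F x = (p.comp (frameMap a b)).comp (M : ℂ →ₗ[ℝ] ℂ) := by
        ext z
        simp only [hF, Seminorm.comp_apply, h, LinearEquiv.coe_coe, hM]
      rw [this, planarForm_comp, hN.form_eq, hM, norm_mul, Complex.norm_exp_ofReal_mul_I, one_mul]
    obtain ⟨h1, h2, h3⟩ := hFx.coeffs
    rw [← fourierInt_rotate]
    congr 1
    funext z
    rw [Seminorm.comp_apply, hu', hv']
    simp only [h1, h2, h3, one_smul, zero_smul, zero_add]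
    rw [h z, Seminorm.comp_apply]
  have hframe : ∀ (x : ℝ × ℝ) (φ : ℝ), u x = Real.cos φ • a + Real.sin φ • b →
      v x = (-Real.sin φ) • a + Real.cos φ • b → ∀ z, frameMap (u x) (v x) z =
      frameMap a b (Complex.exp (φ * Complex.I) * z) := by
    intro x φ h1 h2 z
    rw [frameMap_apply, frameMap_apply, h1, h2, Complex.mul_re, Complex.mul_im,
      Complex.exp_ofReal_mul_I_re, Complex.exp_ofReal_mul_I_im]
    module
  have hΦ0 : ∀ t : ℝ, fourierInt (p.comp (frameMap (u' (0, t)) (v' (0, t)))) k =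
      Complex.exp (-(k * t * Complex.I)) * fourierInt (p.comp (frameMap a b)) k := fun t =>
    hrot (0, t) t (hframe _ _ (by simp [hu]) (by simp [hv]))
  have hΦ1 : ∀ t : ℝ, fourierInt (p.comp (frameMap (u' (Real.pi, t)) (v' (Real.pi, t)))) k =
      Complex.exp (k * t * Complex.I) * fourierInt (p.comp (frameMap a b)) k := fun t => by
    have := hrot (Real.pi, t) (-t) (hframe _ _ (by simp [hu]) (by simp [hv]))
    rw [this]
    congr 2
    push_cast
    ring
  have hΦc : Continuous fun x => fourierInt (p.comp (frameMap (u' x) (v' x))) k := by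
    refine intervalIntegral.continuous_parametric_intervalIntegral_of_continuous' ?_ _ _
    simp only [Function.uncurry_def, Seminorm.comp_apply, frameMap_apply]
    fun_prop
  obtain ⟨x, hx⟩ := exists_zero_of_winding hΦc (neg_ne_zero.2 hk)
    (fun s => by
      have e1 : u (s, 2 * Real.pi) = u (s, 0) := by simp [hu]
      have e2 : v (s, 2 * Real.pi) = v (s, 0) := by simp [hv]
      simp only [hu', hv', hF, e1, e2])
    (fun t => by
      simp only [hΦ0]
      simp)
    (fun t => by
      simp only [hΦ1]
      simp)
  exact ⟨_, (hnorm x).1, (hnorm x).2, hx⟩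

lemma exists_linearIndependent_extend {V : Type*} [AddCommGroup V] [Module ℝ V]
    [FiniteDimensional ℝ V] (hdim : 3 ≤ Module.finrank ℝ V) {ι : ℂ →ₗ[ℝ] V}
    (hι : Function.Injective ι) : ∃ c, LinearIndependent ℝ ![ι 1, ι Complex.I, c] := by
  have hrank : Module.finrank ℝ (LinearMap.range ι) = 2 := by
    rw [LinearMap.finrank_range_of_inj hι, Complex.finrank_real_complex]
  have hne : LinearMap.range ι ≠ ⊤ := fun h => by
    rw [h, finrank_top] at hrank
    omega
  obtain ⟨c, -, hc⟩ := SetLike.exists_of_lt (lt_top_iff_ne_top.2 hne)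
  refine ⟨c, Fintype.linearIndependent_iff.2 fun g hg => ?_⟩
  rw [Fin.sum_univ_three] at hg
  simp only [Matrix.cons_val_zero, Matrix.cons_val_one, Matrix.cons_val] at hg
  have hz : ι (g 0 • 1 + g 1 • Complex.I) = -(g 2 • c) := by
    rw [map_add, map_smul, map_smul]
    exact eq_neg_of_add_eq_zero_left hg
  have h2 : g 2 = 0 := by
    by_contra h
    refine hc ⟨-(g 2)⁻¹ • (g 0 • 1 + g 1 • Complex.I), ?_⟩
    rw [map_smul, hz, neg_smul, smul_neg, neg_neg, inv_smul_smul₀ h]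
  rw [h2, zero_smul, neg_zero] at hz
  have h0 := hι (hz.trans (map_zero ι).symm)
  have hr := congrArg Complex.re h0
  have hi := congrArg Complex.im h0
  simp at hr hi
  intro i
  fin_cases i
  · exact hr
  · exact hi
  · exact h2

/-- A normalised planar norm with small Fourier coefficients is nearly Euclidean. -/
lemma exists_near_euclidean_bound (C : ℝ) (hC : 0 < C) : ∃ D : ℝ, 0 < D ∧ ∀ N : Seminorm ℝ ℂ,
    IsNormalised N → ∀ ε : ℝ, 0 < ε → ε ≤ 1 →
    (∀ k : ℤ, k ≠ 0 → ‖fourierInt N k‖ ≤ C * ε ^ 3) →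
    ∃ r : ℝ, 0 < r ∧ ∀ z, r * ‖z‖ ≤ N z ∧ N z ≤ (1 + D * ε) * (r * ‖z‖) := by
  obtain ⟨a, b, ha, hb, hab⟩ := exists_normalised_bounds
  have hpi := Real.pi_pos
  set B := 2 * C + 4 * Real.pi * b with hB
  have hBpos : 0 < B := by positivity
  refine ⟨B / a, by positivity, fun N hN ε hε hε1 hk => ?_⟩
  set M := ⌈(ε ^ 2)⁻¹⌉₊ with hM
  have hε2 : 1 ≤ (ε ^ 2)⁻¹ := (one_le_inv₀ (by positivity)).2 (pow_le_one₀ hε.le hε1)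
  have hM1 : (ε ^ 2)⁻¹ ≤ M := Nat.le_ceil _
  have hM2 : (M : ℝ) ≤ 2 * (ε ^ 2)⁻¹ := by
    have := (Nat.ceil_lt_add_one (zero_le_one.trans hε2)).le
    linarith
  have hMpos : 0 < M := by exact_mod_cast zero_lt_one.trans_le (hε2.trans hM1)
  have hsq : ε⁻¹ ≤ Real.sqrt M := by
    refine Real.le_sqrt_of_sq_le ?_
    rwa [inv_pow]
  have hlip : ∀ z w, |N z - N w| ≤ b * ‖z - w‖ := fun z w =>
    (abs_sub_map_le_sub N z w).trans (hab N hN _).2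
  have hosc : ∀ z, ‖z‖ = 1 → |2 * Real.pi * N z -
      ∫ t in (0 : ℝ)..2 * Real.pi, N (Complex.exp (t * Complex.I))| ≤ B * ε := by
    intro z hz
    have h := abs_sub_mean_le hb.le hN.continuous hlip (η := C * ε ^ 3) (by positivity) hk hMpos
      z.arg
    have hz' : Complex.exp (z.arg * Complex.I) = z := by
      have := Complex.norm_mul_exp_arg_mul_I z
      rwa [hz, Complex.ofReal_one, one_mul] at this
    rw [hz'] at h
    refine h.trans ?_
    have h1 : M * (C * ε ^ 3) ≤ 2 * C * ε := by
      calc M * (C * ε ^ 3) ≤ 2 * (ε ^ 2)⁻¹ * (C * ε ^ 3) := by gcongr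
        _ = 2 * C * ε := by field_simp
    have h2 : 4 * Real.pi * b / Real.sqrt M ≤ 4 * Real.pi * b * ε := by
      calc 4 * Real.pi * b / Real.sqrt M ≤ 4 * Real.pi * b / ε⁻¹ := by gcongr
        _ = _ := by rw [div_inv_eq_mul]
    rw [hB]
    linarith
  obtain ⟨y, hy, hmin⟩ := exists_sphere_min hN.continuous
  have hay : a ≤ N y := by simpa [hy] using (hab N hN y).1
  have hypos : 0 < N y := ha.trans_le hay
  refine ⟨N y, hypos, fun z => ⟨hmin z, ?_⟩⟩
  have hunit : ∀ w, ‖w‖ = 1 → N w ≤ (1 + B / a * ε) * N y := by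
    intro w hw
    have h1 := abs_le.1 (hosc w hw)
    have h2 := abs_le.1 (hosc y hy)
    have h3 : 2 * Real.pi * (N w - N y) ≤ 2 * Real.pi * (B * ε) := by
      have : 1 * (B * ε) ≤ Real.pi * (B * ε) := by
        gcongr
        linarith [Real.pi_gt_three]
      nlinarith [h1.2, h2.1]
    have h4 : N w - N y ≤ B * ε := le_of_mul_le_mul_left h3 (by positivity)
    have h5 : B * ε ≤ B / a * ε * N y := by
      calc B * ε = B / a * ε * a := by field_simp
        _ ≤ _ := by gcongr
    linarith
  rcases eq_or_ne z 0 with rfl | hz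
  · simp
  have hz' : 0 < ‖z‖ := norm_pos_iff.2 hz
  have h := hunit (‖z‖⁻¹ • z) (by simp [hz'.ne'])
  rw [map_smul_eq_mul, norm_inv, norm_norm, inv_mul_le_iff₀ hz'] at h
  linarith

/-- If all plane sections of a norm are `δ`-close to each other, then they are all
`O(δ^{1/3})`-close to being Euclidean. -/
lemma exists_planar_sections_bound : ∃ D : ℝ, 0 < D ∧
    ∀ {V : Type} [NormedAddCommGroup V] [NormedSpace ℝ V] [FiniteDimensional ℝ V]
      {p : Seminorm ℝ V}, 3 ≤ Module.finrank ℝ V → Continuous p → (∀ x, p x = 0 → x = 0) →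
    ∀ ε : ℝ, 0 < ε → ε ≤ 1 →
    (∀ ι ι' : ℂ →ₗ[ℝ] V, Function.Injective ι → Function.Injective ι' → ∃ T : ℂ ≃ₗ[ℝ] ℂ,
      ∀ z, p (ι' z) ≤ p (ι (T z)) ∧ p (ι (T z)) ≤ (1 + ε ^ 3) * p (ι' z)) →
    ∀ ι : ℂ →ₗ[ℝ] V, Function.Injective ι → ∃ A : ℂ →ₗ[ℝ] ℂ,
      ∀ z, ‖A z‖ ≤ p (ι z) ∧ p (ι z) ≤ (1 + D * ε) * ‖A z‖ := by
  obtain ⟨C, hC, hfour⟩ := exists_fourierInt_bound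
  obtain ⟨D, hD, hnear⟩ := exists_near_euclidean_bound C hC
  refine ⟨D, hD, fun {V} _ _ _ {p} hdim hp hp0 ε hε hε1 hsec ι hι => ?_⟩
  obtain ⟨hGinj, hG⟩ := isNormalised_comp_frameMap (continuous_seminorm_comp hp ι)
    (definite_seminorm_comp hp0 hι)
  set G := frameMap (normAlpha (p.comp ι) : ℂ)
    (normBeta (p.comp ι) + normGamma (p.comp ι) * Complex.I) with hGdef
  set ι₀ := ι.comp G with hι₀
  have hι₀inj : Function.Injective ι₀ := hι.comp hGinj
  have hnorm : IsNormalised (p.comp ι₀) := hG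
  obtain ⟨c, hc⟩ := exists_linearIndependent_extend hdim hι₀inj
  have hframe : frameMap (ι₀ 1) (ι₀ Complex.I) = ι₀ := by
    refine LinearMap.ext fun z => ?_
    rw [frameMap_apply, ← map_smul, ← map_smul, ← map_add]
    congr 1
    apply Complex.ext <;> simp
  obtain ⟨r, hr, hN⟩ := hnear (p.comp ι₀) hnorm ε hε hε1 fun k hk => by
    obtain ⟨ι₁, hι₁, hn₁, hz₁⟩ := exists_fourierInt_eq_zero hp hp0 hc
      (by rwa [hframe]) hk
    obtain ⟨T, hT⟩ := hsec ι₁ ι₀ hι₁ hι₀inj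
    exact hfour _ _ hn₁ hnorm T (ε ^ 3) (by positivity) (pow_le_one₀ hε.le hε1)
      (fun z => (hT z).1) (fun z => (hT z).2) k hz₁
  set e := LinearEquiv.ofInjectiveEndo G hGinj with he
  refine ⟨r • (e.symm : ℂ →ₗ[ℝ] ℂ), fun z => ?_⟩
  have hz : p (ι z) = p.comp ι₀ (e.symm z) := by
    rw [Seminorm.comp_apply, hι₀, LinearMap.comp_apply]
    congr 2
    exact (e.apply_symm_apply z).symm
  have hA : ‖(r • (e.symm : ℂ →ₗ[ℝ] ℂ)) z‖ = r * ‖e.symm z‖ := by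
    rw [LinearMap.smul_apply, norm_smul, Real.norm_of_nonneg hr.le]
    rfl
  rw [hz, hA]
  exact hN _

lemma Seminorm.le_mul_of_forall_le_one {V : Type*} [AddCommGroup V] [Module ℝ V]
    {p q : Seminorm ℝ V} {c : ℝ} (hc : 0 < c) (h : ∀ x, q x ≤ 1 → p x ≤ c) (x : V) :
    p x ≤ c * q x := by
  rw [← div_le_iff₀' hc]
  refine le_of_forall_gt_imp_ge_of_dense fun s hs => ?_
  have hs0 : 0 < s := (apply_nonneg q x).trans_lt hs
  have h1 := h (s⁻¹ • x) (by
    rw [map_smul_eq_mul, Real.norm_of_nonneg (inv_nonneg.2 hs0.le), inv_mul_le_iff₀ hs0]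
    linarith)
  rw [map_smul_eq_mul, Real.norm_of_nonneg (inv_nonneg.2 hs0.le), inv_mul_le_iff₀ hs0] at h1
  rwa [div_le_iff₀ hc]

lemma Seminorm.half_sub_le_one {V : Type*} [AddCommGroup V] [Module ℝ V] (p : Seminorm ℝ V)
    {a b : V} (ha : p a ≤ 1) (hb : p b ≤ 1) : p ((1 / 2 : ℝ) • (a - b)) ≤ 1 := by
  rw [map_smul_eq_mul, Real.norm_of_nonneg (by norm_num)]
  linarith [map_sub_le_add p a b]

/-- For unit balls of seminorms, the affine map in the definition of the Banach–Mazur distance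
can be replaced by its linear part. -/
lemma exists_linearEquiv_of_dBMlt {V W : Type*} [AddCommGroup V] [Module ℝ V]
    [AddCommGroup W] [Module ℝ W] {p : Seminorm ℝ V} {q : Seminorm ℝ W} {lam : ℝ}
    (hlam : 0 < lam) (h : dBMlt {x | p x ≤ 1} {y | q y ≤ 1} lam) :
    ∃ L : W ≃ₗ[ℝ] V, ∀ y, q y ≤ p (L y) ∧ p (L y) ≤ lam * q y := by
  obtain ⟨T, z, h1, h2⟩ := h
  have hT : ∀ y y', T y - T y' = T.linear (y - y') := fun y y' => by
    simpa using (T.toAffineMap.linearMap_vsub y y').symm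
  refine ⟨T.linear, fun y => ⟨?_, ?_⟩⟩
  · have := Seminorm.le_mul_of_forall_le_one (p := q.comp (T.linear.symm : V →ₗ[ℝ] W)) (q := p)
      one_pos (fun x hx => ?_) (T.linear y)
    · simpa using this
    obtain ⟨a, ha, hax⟩ := h1 (show p x ≤ 1 from hx)
    obtain ⟨b, hb, hbx⟩ := h1 (show p (-x) ≤ 1 by rwa [map_neg_eq_map])
    have hab : T.linear ((1 / 2 : ℝ) • (a - b)) = x := by
      rw [map_smul, ← hT, hax, hbx]
      module
    rw [← hab]
    simpa using q.half_sub_le_one ha hb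
  · refine Seminorm.le_mul_of_forall_le_one (p := p.comp (T.linear : W →ₗ[ℝ] V)) (q := q)
      hlam (fun x hx => ?_) y
    have hmem : ∀ x, q x ≤ 1 → ∃ a, p a ≤ 1 ∧ T x = lam • a + z := by
      intro x hx
      obtain ⟨_, ⟨a, ha, rfl⟩, _, rfl, hw⟩ := h2 ⟨x, hx, rfl⟩
      exact ⟨a, ha, hw.symm⟩
    obtain ⟨a, ha, hax⟩ := hmem x hx
    obtain ⟨b, hb, hbx⟩ := hmem (-x) (by rwa [map_neg_eq_map])
    have hab : T.linear x = lam • (1 / 2 : ℝ) • (a - b) := by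
      have : x = (1 / 2 : ℝ) • (x - -x) := by module
      rw [this, map_smul, ← hT, hax, hbx]
      module
    rw [Seminorm.comp_apply, LinearEquiv.coe_coe, hab, map_smul_eq_mul,
      Real.norm_of_nonneg hlam.le]
    exact mul_le_of_le_one_right hlam.le (p.half_sub_le_one ha hb)

/-- If the two-dimensional sections of the unit ball of a seminorm are pairwise close in the
Banach–Mazur distance, then so are the restrictions of the seminorm to planes. -/
lemma exists_linearEquiv_of_dBMlt_sections {V : Type*} [AddCommGroup V] [Module ℝ V]
    {p : Seminorm ℝ V} {lam : ℝ} (hlam : 0 < lam)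
    (h : ∀ E F : Submodule ℝ V, Module.finrank ℝ E = 2 → Module.finrank ℝ F = 2 →
      dBMlt (Subtype.val ⁻¹' {x | p x ≤ 1} : Set E) (Subtype.val ⁻¹' {x | p x ≤ 1} : Set F) lam)
    (ι ι' : ℂ →ₗ[ℝ] V) (hι : Function.Injective ι) (hι' : Function.Injective ι') :
    ∃ T : ℂ ≃ₗ[ℝ] ℂ, ∀ z, p (ι' z) ≤ p (ι (T z)) ∧ p (ι (T z)) ≤ lam * p (ι' z) := by
  have hrank : ∀ j : ℂ →ₗ[ℝ] V, Function.Injective j → Module.finrank ℝ (LinearMap.range j) = 2 :=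
    fun j hj => by rw [LinearMap.finrank_range_of_inj hj, Complex.finrank_real_complex]
  obtain ⟨L, hL⟩ := exists_linearEquiv_of_dBMlt
    (p := p.comp (LinearMap.range ι).subtype) (q := p.comp (LinearMap.range ι').subtype) hlam
    (h _ _ (hrank ι hι) (hrank ι' hι'))
  refine ⟨(LinearEquiv.ofInjective ι' hι').trans (L.trans (LinearEquiv.ofInjective ι hι).symm),
    fun z => ?_⟩
  have hz : ι (((LinearEquiv.ofInjective ι' hι').trans
      (L.trans (LinearEquiv.ofInjective ι hι).symm)) z) =
      L (LinearEquiv.ofInjective ι' hι' z) := by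
    rw [LinearEquiv.trans_apply, LinearEquiv.trans_apply, ← LinearEquiv.ofInjective_apply (h := hι),
      LinearEquiv.apply_symm_apply]
  rw [hz]
  simpa using hL (LinearEquiv.ofInjective ι' hι' z)

/-- A centrally symmetric convex body is the unit ball of a continuous norm. -/
lemma exists_seminorm_of_symmetric_convexBody {V : Type*} [NormedAddCommGroup V]
    [NormedSpace ℝ V] {K : Set V} (hK : IsCompact K) (hconv : Convex ℝ K)
    (hinterior : (interior K).Nonempty) (hsymm : K = -K) :
    ∃ p : Seminorm ℝ V, Continuous p ∧ (∀ x, p x = 0 → x = 0) ∧ K = {x | p x ≤ 1} := by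
  have hneg : ∀ x ∈ K, -x ∈ K := fun x hx => by rw [hsymm]; simpa using hx
  obtain ⟨x, hx⟩ := hinterior
  have h0 : K ∈ nhds (0 : V) := by
    rw [← mem_interior_iff_mem_nhds]
    have hx' : -x ∈ K := hneg x (interior_subset hx)
    have := hconv.combo_interior_self_mem_interior hx hx' (a := 1 / 2) (b := 1 / 2)
      (by norm_num) (by norm_num) (by norm_num)
    simpa using this
  have habs : Absorbent ℝ K := absorbent_nhds_zero h0
  have hb : Bornology.IsVonNBounded ℝ K := NormedSpace.isVonNBounded_of_isBounded ℝ hK.isBounded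
  let p : Seminorm ℝ V := Seminorm.of (gauge K) (gauge_add_le hconv habs) fun a x => by
    rcases le_total 0 a with ha | ha
    · rw [gauge_smul_of_nonneg ha, Real.norm_of_nonneg ha, smul_eq_mul]
    · rw [← gauge_neg hneg, ← neg_smul, gauge_smul_of_nonneg (neg_nonneg.2 ha),
        Real.norm_of_nonpos ha, smul_eq_mul]
  refine ⟨p, continuous_gauge hconv h0, fun x hx => (gauge_eq_zero habs hb).1 hx, ?_⟩
  ext y
  change _ ↔ gauge K y ≤ 1
  rw [gauge_le_one_iff_mem_closure hconv h0, hK.isClosed.closure_eq]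

lemma dBMlt_closedBall_of_norm_bounds {V : Type*} [NormedAddCommGroup V] [NormedSpace ℝ V]
    {p : Seminorm ℝ V} {lam : ℝ} (hlam : 0 < lam) (T : V ≃ₗ[ℝ] V)
    (hle : ∀ x, p (T x) ≤ ‖x‖) (hge : ∀ x, ‖x‖ ≤ lam * p (T x)) :
    dBMlt {x | p x ≤ 1} (closedBall (0 : V) 1) lam := by
  refine ⟨(T.trans (LinearEquiv.smulOfNeZero ℝ V lam hlam.ne')).toAffineEquiv, 0, ?_, ?_⟩
  · intro x hx
    refine ⟨T.symm (lam⁻¹ • x), ?_, by simp [hlam.ne']⟩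
    rw [mem_closedBall_zero_iff]
    refine (hge _).trans ?_
    rw [T.apply_symm_apply, map_smul_eq_mul, Real.norm_of_nonneg (by positivity),
      mul_inv_cancel_left₀ hlam.ne']
    exact hx
  · rintro _ ⟨x, hx, rfl⟩
    rw [mem_closedBall_zero_iff] at hx
    rw [add_singleton]
    simp only [add_zero, image_id']
    exact ⟨T x, (hle x).trans hx, by simp⟩

theorem stmt2 :
    ∃ c : ℝ, 0 < c ∧
      ∀ (n : ℕ), 3 ≤ n →
        ∀ K : Set (EuclideanSpace ℝ (Fin n)),
          IsCompact K → Convex ℝ K → (interior K).Nonempty → K = -K →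
            ∀ δ : ℝ, 0 < δ →
              (∀ E F : Submodule ℝ (EuclideanSpace ℝ (Fin n)),
                Module.finrank ℝ E = 2 → Module.finrank ℝ F = 2 →
                dBMlt (Subtype.val ⁻¹' K : Set E) (Subtype.val ⁻¹' K : Set F) (1 + δ)) →
              dBMlt K (closedBall (0 : EuclideanSpace ℝ (Fin n)) 1)
                (1 + c * (n : ℝ) ^ 2 * δ ^ ((1 : ℝ) / 3)) := by
  obtain ⟨D, hD, hsections⟩ := exists_planar_sections_bound
  refine ⟨408 * D + 1, by positivity, fun n hn K hK hconv hinterior hsymm δ hδ h => ?_⟩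
  obtain ⟨p, hp, hp0, rfl⟩ := exists_seminorm_of_symmetric_convexBody hK hconv hinterior hsymm
  have hn3 : (3 : ℝ) ≤ n := by exact_mod_cast hn
  have hrank : Module.finrank ℝ (EuclideanSpace ℝ (Fin n)) = n := by simp
  have : Nontrivial (EuclideanSpace ℝ (Fin n)) :=
    Module.nontrivial_of_finrank_pos (R := ℝ) (by omega)
  set ε := δ ^ ((1 : ℝ) / 3) with hεdef
  have hε : 0 < ε := by positivity
  have hε3 : ε ^ 3 = δ := by
    rw [hεdef, ← Real.rpow_natCast, ← Real.rpow_mul hδ.le]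
    norm_num
  obtain ⟨T, hle, hJ⟩ := exists_john_position hp hp0
  set S : EuclideanSpace ℝ (Fin n) →ₗ[ℝ] EuclideanSpace ℝ (Fin n) := T.toLinearMap
  have hle' : ∀ x, p.comp S x ≤ ‖x‖ := hle
  have hJ' : ∀ x, ‖x‖ = 1 → ∀ s : ℝ, 0 ≤ s → ∃ y, ‖y‖ = 1 ∧ 1 + s ≤
      p.comp S (y + (s * inner ℝ x y) • x) ^
        Module.finrank ℝ (EuclideanSpace ℝ (Fin n)) := hJ
  have hnonneg : ∀ x, 0 ≤ p (T x) := fun x => apply_nonneg p _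
  refine dBMlt_closedBall_of_norm_bounds (by positivity) T.toLinearEquiv hle fun x => ?_
  change ‖x‖ ≤ _ * p (T x)
  rcases le_total ε 1 with hε1 | hε1
  · have hplane := hsections (hn.trans_eq hrank.symm) hp hp0 ε hε hε1
      (exists_linearEquiv_of_dBMlt_sections (by positivity) (by rwa [hε3]))
    have hx := norm_le_of_planar_sections (p := p.comp S)
      (by omega) (continuous_seminorm_comp hp _) hle' hJ' (mul_pos hD hε)
      (fun ι hι => hplane (S.comp ι)
        (T.injective.comp hι)) x
    rw [hrank] at hx
    refine hx.trans (mul_le_mul_of_nonneg_right ?_ (hnonneg x))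
    have : 0 ≤ (n : ℝ) ^ 2 * ε := by positivity
    linarith
  · rcases eq_or_ne x 0 with rfl | hx
    · simp
    have hx0 : 0 < ‖x‖ := norm_pos_iff.2 hx
    have hlow := john_position_lower_bound (p := p.comp S) hle'
      (norm_smul_inv_norm (𝕜 := ℝ) hx) (hJ' _ (norm_smul_inv_norm (𝕜 := ℝ) hx))
    rw [hrank, map_smul_eq_mul] at hlow
    have hlow' : ‖x‖ ≤ 2 * n * p (T x) := by
      have h1 := mul_le_mul_of_nonneg_left hlow hx0.le
      simp only [RCLike.ofReal_real_eq_id, id, norm_inv, norm_norm, mul_one] at h1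
      refine h1.trans_eq ?_
      change _ * (_ * (_ * p (T x))) = _
      field_simp
    refine hlow'.trans (mul_le_mul_of_nonneg_right ?_ (hnonneg x))
    have h2 : (n : ℝ) ^ 2 ≤ (n : ℝ) ^ 2 * ε := le_mul_of_one_le_right (by positivity) hε1
    have h3 : 0 ≤ 408 * D * ((n : ℝ) ^ 2 * ε) := by positivity
    nlinarith
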